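/- arXiv:1804.10470 — 5 statements merged into one kernel-verified Lean document; each statement's English description precedes it below -/
import Mathlib

section
/- Let k ≥ 3 and let G be a k-regular graph in which every edge e is assigned a list L_e of labels. If each list has at least ⌈2 + (k−1)/(k−2) · (2(k−1)(k−2)·(k−1)!)^{1/(k−1)}⌉ elements, then there exists a list edge labeling of G distinguishing neighbors by multisets. Moreover, if k ≥ 5435, then this bound is at most 0.37·k. -/
/-- The bound `⌈2 + (k-1)/(k-2) · (2(k-1)(k-2)·(k-1)!)^{1/(k-1)}⌉` on list sizes. -/
noncomputable def edgeMultisetBound (k : ℕ) : ℕ :=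
  ⌈(2 : ℝ) + (((k : ℝ) - 1) / ((k : ℝ) - 2)) *
    ((2 * ((k : ℝ) - 1) * ((k : ℝ) - 2) * (Nat.factorial (k - 1) : ℝ)) ^
      ((1 : ℝ) / ((k : ℝ) - 1)))⌉₊

namespace EdgeMultiset

section Counting

open Finset

/-- A family of functions that agree outside `A` and take the same multiset of values on `A`
has at most `#A !` members. -/
lemma card_le_factorial_of_map_eq {E : Type*} [DecidableEq E] (A : Finset E)
    (T : Finset (E → ℕ)) (s : Multiset ℕ)
    (hT : ∀ f ∈ T, ∀ g ∈ T, ∀ e ∉ A, f e = g e)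
    (hs : ∀ f ∈ T, Multiset.map f A.val = s) : #T ≤ (#A).factorial := by
  induction A using Finset.induction_on generalizing T s with
  | empty =>
    simp only [card_empty, Nat.factorial_zero]
    exact card_le_one.2 fun f hf g hg => funext fun e => hT f hf g hg e (notMem_empty e)
  | insert a A ha ih =>
    have hcard : #(T.image fun f => f a) ≤ #A + 1 := by
      rcases T.eq_empty_or_nonempty with rfl | ⟨f₀, hf₀⟩
      · simp
      · have hsub : (T.image fun f => f a) ⊆ s.toFinset := by
          intro v hv
          obtain ⟨f, hf, rfl⟩ := mem_image.1 hv
          rw [Multiset.mem_toFinset, ← hs f hf]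
          exact Multiset.mem_map_of_mem f (mem_insert_self a A)
        calc #(T.image fun f => f a) ≤ #s.toFinset := card_le_card hsub
          _ ≤ Multiset.card s := Multiset.toFinset_card_le s
          _ = #A + 1 := by rw [← hs f₀ hf₀, Multiset.card_map, card_val, card_insert_of_notMem ha]
    have hfib : ∀ v ∈ T.image (fun f => f a), #{f ∈ T | f a = v} ≤ (#A).factorial := by
      intro v _
      refine ih _ (s.erase v) ?_ ?_
      · intro f hf g hg e he
        rw [mem_filter] at hf hg
        by_cases hea : e = a
        · rw [hea, hf.2, hg.2]
        · exact hT f hf.1 g hg.1 e (by simp [hea, he])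
      · intro f hf
        rw [mem_filter] at hf
        rw [← hs f hf.1, insert_val_of_notMem ha, Multiset.map_cons, hf.2,
          Multiset.erase_cons_head]
    calc #T ≤ (#A).factorial * #(T.image fun f => f a) := card_le_mul_card_image T _ hfib
      _ ≤ (#A).factorial * (#A + 1) := by gcongr
      _ = (#(insert a A)).factorial := by
        rw [card_insert_of_notMem ha, Nat.factorial_succ, mul_comm]

variable {E ι : Type*} [Fintype E] [DecidableEq E] [Fintype ι]

/-- The labelings of `F` from the lists `L` (extended by `0` outside `F`) such that whenever
`A i ∪ B i` is entirely labeled, the multisets of labels on `A i` and on `B i` differ. -/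
def goodLabelings (L : E → Finset ℕ) (A B : ι → Finset E) (F : Finset E) : Finset (E → ℕ) :=
  {μ ∈ Fintype.piFinset fun e => if e ∈ F then L e else {0} |
    ∀ i, A i ∪ B i ⊆ F → Multiset.map μ (A i).val ≠ Multiset.map μ (B i).val}

variable {L : E → Finset ℕ} {A B : ι → Finset E}

lemma mem_goodLabelings {F : Finset E} {μ : E → ℕ} :
    μ ∈ goodLabelings L A B F ↔ ((∀ e ∈ F, μ e ∈ L e) ∧ ∀ e ∉ F, μ e = 0) ∧
      ∀ i, A i ∪ B i ⊆ F → Multiset.map μ (A i).val ≠ Multiset.map μ (B i).val := by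
  rw [goodLabelings, mem_filter, Fintype.mem_piFinset]
  refine and_congr_left fun _ => ⟨fun h => ⟨fun e he => ?_, fun e he => ?_⟩, fun h e => ?_⟩
  · simpa [he] using h e
  · simpa [he] using h e
  · by_cases he : e ∈ F
    · simpa [he] using h.1 e he
    · simpa [he] using h.2 e he

lemma map_piecewise_of_subset {E : Type*} [DecidableEq E] {F S : Finset E} (h : S ⊆ F) (μ ν : E → ℕ) :
    Multiset.map (F.piecewise μ ν) S.val = Multiset.map μ S.val :=
  Multiset.map_congr rfl fun _ he => piecewise_eq_of_mem _ _ _ (h he)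

/-- Restricting a labeling of `F` to a subset preserves goodness. -/
lemma piecewise_mem_goodLabelings {F F' : Finset E} {μ : E → ℕ} (hF : F' ⊆ F)
    (h : ∀ e ∈ F, μ e ∈ L e)
    (hg : ∀ i, A i ∪ B i ⊆ F' → Multiset.map μ (A i).val ≠ Multiset.map μ (B i).val) :
    F'.piecewise μ 0 ∈ goodLabelings L A B F' := by
  refine mem_goodLabelings.2 ⟨⟨fun e he => ?_, fun e he => ?_⟩, fun i hi => ?_⟩
  · rw [piecewise_eq_of_mem _ _ _ he]
    exact h e (hF he)
  · rw [piecewise_eq_of_notMem _ _ _ he, Pi.zero_apply]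
  · rw [map_piecewise_of_subset (subset_union_left.trans hi),
      map_piecewise_of_subset (subset_union_right.trans hi)]
    exact hg i hi

/-- The labelings of `insert e F` whose restriction to `F` is good but in which the multisets of
labels on `A i` and on `B i` coincide. -/
def badExtensions (L : E → Finset ℕ) (A B : ι → Finset E) (F : Finset E) (e : E) (i : ι) :
    Finset (E → ℕ) :=
  {μ ∈ (goodLabelings L A B F ×ˢ L e).image fun p => Function.update p.1 e p.2 |
    A i ∪ B i ⊆ insert e F ∧ Multiset.map μ (A i).val = Multiset.map μ (B i).val}

lemma card_badExtensions_le {F : Finset E} {e : E} {i : ι}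
    (hdisj : Disjoint (A i) (B i)) (he : e ∈ A i) (heF : e ∉ F) :
    #(badExtensions L A B F e i) ≤
      (#(A i)).factorial * #(goodLabelings L A B (F \ A i)) := by
  set R : (E → ℕ) → (E → ℕ) := fun μ => (F \ A i).piecewise μ 0 with hR
  have hprop : ∀ μ ∈ badExtensions L A B F e i, (∀ x ∈ F, μ x ∈ L x) ∧
      (∀ x ∉ insert e F, μ x = 0) ∧
      (∀ j, A j ∪ B j ⊆ F → Multiset.map μ (A j).val ≠ Multiset.map μ (B j).val) ∧
      B i ⊆ F \ A i ∧ Multiset.map μ (A i).val = Multiset.map μ (B i).val := by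
    intro μ hμ
    obtain ⟨hμ, hsub, heq⟩ := mem_filter.1 hμ
    obtain ⟨⟨f, c⟩, hp, rfl⟩ := mem_image.1 hμ
    obtain ⟨hf, hc⟩ := mem_product.1 hp
    obtain ⟨⟨h1, h2⟩, h3⟩ := mem_goodLabelings.1 hf
    have hupd : ∀ S ⊆ F, Multiset.map (Function.update f e c) S.val = Multiset.map f S.val :=
      fun S hS => Multiset.map_congr rfl fun x hx =>
        Function.update_of_ne (ne_of_mem_of_not_mem (hS hx) heF) _ _
    refine ⟨fun x hx => ?_, fun x hx => ?_, fun j hj => ?_, fun x hx => ?_, heq⟩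
    · rw [Function.update_of_ne (ne_of_mem_of_not_mem hx heF)]
      exact h1 x hx
    · rw [mem_insert, not_or] at hx
      rw [Function.update_of_ne hx.1]
      exact h2 x hx.2
    · rw [hupd _ (subset_union_left.trans hj), hupd _ (subset_union_right.trans hj)]
      exact h3 j hj
    · have hxA : x ∉ A i := fun h => disjoint_left.1 hdisj h hx
      have hxe : x ≠ e := fun h => hxA (h ▸ he)
      have := hsub (mem_union_right _ hx)
      simp only [mem_insert, hxe, false_or] at this
      exact mem_sdiff.2 ⟨this, hxA⟩
  have himage : (badExtensions L A B F e i).image R ⊆ goodLabelings L A B (F \ A i) := by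
    intro ν hν
    obtain ⟨μ, hμ, rfl⟩ := mem_image.1 hν
    obtain ⟨h1, -, h3, -, -⟩ := hprop μ hμ
    exact piecewise_mem_goodLabelings sdiff_subset h1
      fun j hj => h3 j (hj.trans sdiff_subset)
  have hfib : ∀ ν ∈ (badExtensions L A B F e i).image R,
      #{μ ∈ badExtensions L A B F e i | R μ = ν} ≤ (#(A i)).factorial := by
    intro ν _
    refine card_le_factorial_of_map_eq (A i) _ (Multiset.map ν (B i).val) ?_ ?_
    · intro f hf g hg x hx
      obtain ⟨hf, hfν⟩ := mem_filter.1 hf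
      obtain ⟨hg, hgν⟩ := mem_filter.1 hg
      by_cases hxF : x ∈ F
      · have hxF' : x ∈ F \ A i := mem_sdiff.2 ⟨hxF, hx⟩
        have := congrFun (hfν.trans hgν.symm) x
        simpa only [hR, piecewise_eq_of_mem _ _ _ hxF'] using this
      · have hxF' : x ∉ insert e F := by
          rw [mem_insert, not_or]
          exact ⟨fun h => hx (h ▸ he), hxF⟩
        rw [(hprop f hf).2.1 x hxF', (hprop g hg).2.1 x hxF']
    · intro f hf
      obtain ⟨hf, hfν⟩ := mem_filter.1 hf
      obtain ⟨-, -, -, h4, h5⟩ := hprop f hf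
      rw [h5, ← hfν, hR, map_piecewise_of_subset h4]
  exact (card_le_mul_card_image _ _ hfib).trans (Nat.mul_le_mul_left _ (card_le_card himage))

lemma card_mul_card_le [DecidableEq ι] {F : Finset E} {e : E} (heF : e ∉ F)
    (hsymm : ∀ i, ∃ j, A j = B i ∧ B j = A i) :
    #(goodLabelings L A B F) * #(L e) ≤ #(goodLabelings L A B (insert e F)) +
      ∑ i with e ∈ A i ∧ A i ⊆ insert e F, #(badExtensions L A B F e i) := by
  have hinj : Set.InjOn (fun p : (E → ℕ) × ℕ => Function.update p.1 e p.2)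
      (goodLabelings L A B F ×ˢ L e : Finset _) := by
    rintro ⟨f, c⟩ hf ⟨g, d⟩ hg h
    have hf := (mem_goodLabelings.1 (mem_product.1 hf).1).1.2 e heF
    have hg := (mem_goodLabelings.1 (mem_product.1 hg).1).1.2 e heF
    simp only at hf hg h
    have hcd : c = d := by simpa using congrFun h e
    refine Prod.ext (funext fun x => ?_) hcd
    by_cases hx : x = e
    · rw [hx]
      exact hf.trans hg.symm
    · simpa [hx] using congrFun h x
  rw [← card_product, ← card_image_of_injOn hinj]
  refine le_trans (card_le_card ?_) ((card_union_le _ _).trans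
    (Nat.add_le_add_left card_biUnion_le _))
  intro μ hμ
  by_cases hgood : ∀ i, A i ∪ B i ⊆ insert e F →
      Multiset.map μ (A i).val ≠ Multiset.map μ (B i).val
  · refine mem_union_left _ (mem_goodLabelings.2 ⟨?_, hgood⟩)
    obtain ⟨⟨f, c⟩, hp, rfl⟩ := mem_image.1 hμ
    obtain ⟨hf, hc⟩ := mem_product.1 hp
    obtain ⟨⟨h1, h2⟩, -⟩ := mem_goodLabelings.1 hf
    refine ⟨fun x hx => ?_, fun x hx => ?_⟩
    · by_cases hxe : x = e
      · subst hxe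
        simpa using hc
      · simpa [hxe] using h1 x ((mem_insert.1 hx).resolve_left hxe)
    · rw [mem_insert, not_or] at hx
      simpa [hx.1] using h2 x hx.2
  · refine mem_union_right _ (mem_biUnion.2 ?_)
    push Not at hgood
    obtain ⟨i, hi, heq⟩ := hgood
    have hmem : e ∈ A i ∪ B i := by
      by_contra hne
      obtain ⟨⟨f, c⟩, hp, rfl⟩ := mem_image.1 hμ
      have hf := (mem_goodLabelings.1 (mem_product.1 hp).1).2 i
        ((subset_insert_iff_of_notMem hne).1 hi)
      rw [mem_union, not_or] at hne
      have hupd : ∀ S : Finset E, e ∉ S →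
          Multiset.map (Function.update f e c) S.val = Multiset.map f S.val :=
        fun S hS => Multiset.map_congr rfl fun x hx =>
          Function.update_of_ne (ne_of_mem_of_not_mem hx hS) _ _
      exact hf (by simpa only [hupd _ hne.1, hupd _ hne.2] using heq)
    rcases mem_union.1 hmem with h | h
    · exact ⟨i, by simpa [h] using subset_union_left.trans hi, mem_filter.2 ⟨hμ, hi, heq⟩⟩
    · obtain ⟨j, hj1, hj2⟩ := hsymm i
      refine ⟨j, ?_, mem_filter.2 ⟨hμ, ?_, ?_⟩⟩
      · simpa [hj1, h] using subset_union_right.trans hi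
      · rw [hj1, hj2, union_comm]
        exact hi
      · rw [hj1, hj2]
        exact heq.symm

/-- If each single extension multiplies the number of good labelings by at least `β`, up to
size `N`, then so do successive extensions. -/
lemma pow_mul_card_le {β : ℝ} (hβ : 0 ≤ β) {N : ℕ}
    (hstep : ∀ F : Finset E, #F < N → ∀ e ∉ F,
      β * #(goodLabelings L A B F) ≤ #(goodLabelings L A B (insert e F)))
    (F T : Finset E) (hdisj : Disjoint F T) (hN : #F + #T ≤ N) :
    β ^ #T * #(goodLabelings L A B F) ≤ (#(goodLabelings L A B (F ∪ T)) : ℝ) := by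
  induction T using Finset.induction_on with
  | empty => simp
  | insert a T ha ih =>
    rw [card_insert_of_notMem ha] at hN ⊢
    rw [disjoint_insert_right] at hdisj
    have haFT : a ∉ F ∪ T := by simp [hdisj.1, ha]
    have h := hstep (F ∪ T) (by rw [card_union_of_disjoint hdisj.2]; omega) a haFT
    rw [union_insert]
    refine le_trans ?_ h
    rw [pow_succ', mul_assoc]
    exact mul_le_mul_of_nonneg_left (ih hdisj.2 (by omega)) hβ

lemma mul_card_le_card_insert [DecidableEq ι] {m D ℓ : ℕ} {β : ℝ} (hβ : 0 < β)
    (hL : ∀ e, ℓ ≤ #(L e)) (hA : ∀ i, #(A i) = m + 1)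
    (hdisj : ∀ i, Disjoint (A i) (B i)) (hsymm : ∀ i, ∃ j, A j = B i ∧ B j = A i)
    (hD : ∀ e, #{i | e ∈ A i} ≤ D)
    (hβℓ : β + D * (m + 1).factorial / β ^ m ≤ ℓ) (F : Finset E) (e : E) (heF : e ∉ F) :
    β * #(goodLabelings L A B F) ≤ (#(goodLabelings L A B (insert e F)) : ℝ) := by
  induction hN : #F using Nat.strong_induction_on generalizing F e with
  | _ N ih =>
  have hcount : (ℓ : ℝ) * #(goodLabelings L A B F) ≤ #(goodLabelings L A B (insert e F)) +
      ∑ i with e ∈ A i ∧ A i ⊆ insert e F, (#(badExtensions L A B F e i) : ℝ) := by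
    have h := card_mul_card_le (L := L) heF hsymm
    have h2 := Nat.mul_le_mul_left #(goodLabelings L A B F) (hL e)
    rw [mul_comm]
    exact_mod_cast h2.trans h
  have hbad : ∀ i ∈ ({i | e ∈ A i ∧ A i ⊆ insert e F} : Finset ι),
      (#(badExtensions L A B F e i) : ℝ) ≤
        (m + 1).factorial / β ^ m * #(goodLabelings L A B F) := by
    intro i hi
    obtain ⟨hei, hAi⟩ := (mem_filter.1 hi).2
    have hsub : (A i).erase e ⊆ F := subset_insert_iff.1 hAi
    have hsd : F \ A i = F \ (A i).erase e := by
      ext x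
      simp only [mem_sdiff, mem_erase, not_and]
      exact and_congr_right fun hx =>
        ⟨fun h _ => h, fun h => h (ne_of_mem_of_not_mem hx heF)⟩
    have hcardA : #((A i).erase e) = m := by rw [card_erase_of_mem hei, hA]; rfl
    have hpow := pow_mul_card_le (L := L) (A := A) (B := B) hβ.le
      (fun F' hF' e' he' => ih #F' hF' F' e' he' rfl) (F \ (A i).erase e) ((A i).erase e)
      sdiff_disjoint (by rw [card_sdiff_add_card_eq_card hsub, hN])
    rw [sdiff_union_of_subset hsub, hcardA, ← hsd] at hpow
    have hb := card_badExtensions_le (L := L) (F := F) (hdisj i) hei heF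
    rw [hA i] at hb
    have hb' : (#(badExtensions L A B F e i) : ℝ) ≤
        (m + 1).factorial * #(goodLabelings L A B (F \ A i)) := by exact_mod_cast hb
    rw [div_mul_eq_mul_div, le_div_iff₀ (by positivity)]
    calc (#(badExtensions L A B F e i) : ℝ) * β ^ m
        ≤ (m + 1).factorial * #(goodLabelings L A B (F \ A i)) * β ^ m := by gcongr
      _ = (m + 1).factorial * (β ^ m * #(goodLabelings L A B (F \ A i))) := by ring
      _ ≤ (m + 1).factorial * #(goodLabelings L A B F) := by gcongr
  have hsum := sum_le_card_nsmul _ _ _ hbad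
  have hcard : #{i | e ∈ A i ∧ A i ⊆ insert e F} ≤ D :=
    (card_le_card fun i hi => by
      simp only [mem_filter, mem_univ, true_and] at hi ⊢
      exact hi.1).trans (hD e)
  rw [nsmul_eq_mul] at hsum
  have hsum2 : (#{i | e ∈ A i ∧ A i ⊆ insert e F} : ℝ) *
      ((m + 1).factorial / β ^ m * #(goodLabelings L A B F)) ≤
      D * ((m + 1).factorial / β ^ m * #(goodLabelings L A B F)) := by gcongr
  have hfinal := mul_le_mul_of_nonneg_right hβℓ
    (Nat.cast_nonneg (α := ℝ) #(goodLabelings L A B F))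
  have e1 : (β + D * (m + 1).factorial / β ^ m) * #(goodLabelings L A B F) =
      β * #(goodLabelings L A B F) +
        D * ((m + 1).factorial / β ^ m * #(goodLabelings L A B F)) := by ring
  linarith

/-- Rosenfeld-type counting criterion: there is a labeling from lists of size `ℓ` such that the
multisets of labels on `A i` and on `B i` differ for all `i`. -/
lemma exists_labeling_of_counting [DecidableEq ι] {m D ℓ : ℕ} {β : ℝ} (hβ : 0 < β)
    (hL : ∀ e, ℓ ≤ #(L e)) (hA : ∀ i, #(A i) = m + 1)
    (hdisj : ∀ i, Disjoint (A i) (B i)) (hsymm : ∀ i, ∃ j, A j = B i ∧ B j = A i)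
    (hD : ∀ e, #{i | e ∈ A i} ≤ D)
    (hβℓ : β + D * (m + 1).factorial / β ^ m ≤ ℓ) :
    ∃ μ : E → ℕ, (∀ e, μ e ∈ L e) ∧
      ∀ i, Multiset.map μ (A i).val ≠ Multiset.map μ (B i).val := by
  have hempty : (0 : E → ℕ) ∈ goodLabelings L A B ∅ := by
    refine mem_goodLabelings.2 ⟨by simp, fun i hi => ?_⟩
    have h := hA i
    rw [subset_empty.1 (subset_union_left.trans hi)] at h
    simp at h
  have h := pow_mul_card_le (L := L) (A := A) (B := B) hβ.le (N := #(univ : Finset E))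
    (fun F _ e he => mul_card_le_card_insert hβ hL hA hdisj hsymm hD hβℓ F e he) ∅ univ
    (disjoint_empty_left _) (by simp)
  have hpos : (0 : ℝ) < #(goodLabelings L A B (∅ ∪ univ)) :=
    lt_of_lt_of_le (mul_pos (by positivity) (by exact_mod_cast card_pos.2 ⟨0, hempty⟩)) h
  obtain ⟨μ, hμ⟩ := card_pos.1 (by exact_mod_cast hpos)
  obtain ⟨⟨h1, -⟩, h3⟩ := mem_goodLabelings.1 hμ
  exact ⟨μ, fun e => h1 e (by simp), fun i => h3 i (by simp)⟩

end Counting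

section Asymptotics

open Real

lemma neg_sub_sq_sub_cube_le_log_one_sub {y : ℝ} (h0 : 0 ≤ y) (h1 : y < 1) :
    -(y + y ^ 2 / 2 + y ^ 3 / (1 - y)) ≤ log (1 - y) := by
  have h := abs_log_sub_add_sum_range_le (x := y) (by rwa [abs_of_nonneg h0]) 2
  rw [abs_of_nonneg h0] at h
  have h2 := (abs_le.1 h).1
  norm_num [Finset.sum_range_succ] at h2
  linarith

/-- For fixed `b`, the quantity `x * log (1 - b / x)` is bounded below on `[x₀, ∞)`. -/
lemma neg_le_mul_log_one_sub_div {b x₀ x : ℝ} (hb : 0 < b) (hx₀ : b < x₀) (hx : x₀ ≤ x) :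
    -(b + b ^ 2 / (2 * x₀) + b ^ 3 / (x₀ * (x₀ - b))) ≤ x * log (1 - b / x) := by
  have h0 : 0 < x₀ := hb.trans hx₀
  have hx0 : 0 < x := h0.trans_le hx
  have hbx : 0 < x - b := by linarith
  have hbx₀ : 0 < x₀ - b := by linarith
  have h := neg_sub_sq_sub_cube_le_log_one_sub (y := b / x) (by positivity)
    ((div_lt_one hx0).2 (by linarith))
  have h2 := mul_le_mul_of_nonneg_left h hx0.le
  have e : x * -(b / x + (b / x) ^ 2 / 2 + (b / x) ^ 3 / (1 - b / x)) =
      -(b + b ^ 2 / (2 * x) + b ^ 3 / (x * (x - b))) := by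
    have : 1 - b / x = (x - b) / x := by field_simp
    rw [this]
    field_simp
  rw [e] at h2
  refine le_trans ?_ h2
  have h3 : b ^ 2 / (2 * x) ≤ b ^ 2 / (2 * x₀) := by gcongr
  have h4 : b ^ 3 / (x * (x - b)) ≤ b ^ 3 / (x₀ * (x₀ - b)) := by gcongr
  linarith

lemma stirlingSeq_fifty_le : Stirling.stirlingSeq 50 ≤ 1.7755 := by
  have h : √(2 * (50 : ℕ) : ℝ) = 10 := by
    rw [show (2 * (50 : ℕ) : ℝ) = 10 ^ 2 by norm_num]
    exact Real.sqrt_sq (by norm_num)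
  have he : exp 1 ^ 50 ≤ 2.7182818286 ^ 50 := by
    gcongr
    exact exp_one_lt_d9.le
  rw [Stirling.stirlingSeq, h, div_pow, div_le_iff₀ (by positivity), ← mul_assoc, mul_div_assoc',
    le_div_iff₀ (by positivity)]
  refine (mul_le_mul_of_nonneg_left he (by positivity)).trans ?_
  norm_num [Nat.factorial]

lemma log_factorial_le {n : ℕ} (hn : 50 ≤ n) :
    log n.factorial ≤ log 1.7755 + 1 / 2 * (log 2 + log n) + n * (log n - 1) := by
  have hn0 : (0 : ℝ) < n := by exact_mod_cast (by omega : 0 < n)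
  obtain ⟨m, rfl⟩ : ∃ m, n = m + 1 := ⟨n - 1, by omega⟩
  have h1 : Stirling.stirlingSeq (m + 1) ≤ 1.7755 :=
    (Stirling.stirlingSeq'_antitone (show 49 ≤ m by omega)).trans stirlingSeq_fifty_le
  have h2 := log_le_log (Stirling.stirlingSeq'_pos m) h1
  rw [Stirling.log_stirlingSeq_formula, log_mul (by norm_num) hn0.ne',
    log_div hn0.ne' (exp_pos 1).ne', log_exp] at h2
  linarith

set_option exponentiation.threshold 700 in
lemma log_const_le : 3 / 2 * log 2 + log 1.7755 + 5 / 2 * log 5434 ≤ 601 / 26 := by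
  have h : log ((8 * 1.7755 ^ 2 * 5434 ^ 5) ^ 13) ≤ 601 := by
    rw [log_le_iff_le_exp (by positivity), show (601 : ℝ) = (601 : ℕ) * 1 by norm_num, exp_nat_mul]
    refine le_trans ?_ (pow_le_pow_left₀ (by norm_num) exp_one_gt_d9.le 601)
    norm_num
  rw [log_pow, log_mul (by positivity) (by positivity), log_mul (by positivity) (by positivity),
    log_pow, log_pow, show (8 : ℝ) = 2 ^ 3 by norm_num, log_pow] at h
  push_cast at h
  linarith

lemma log_const_ge : 0.0057477 ≤ 1 + log 0.37 := by
  have h := le_log_one_add_of_nonneg (x := 0.37 * 2.7182818283 - 1) (by norm_num)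
  have h2 : log (1 + (0.37 * 2.7182818283 - 1)) ≤ log (0.37 * exp 1) := by
    apply log_le_log (by norm_num)
    have := exp_one_gt_d9
    linarith
  rw [log_mul (by norm_num) (exp_pos 1).ne', log_exp] at h2
  norm_num at h h2 ⊢
  linarith

lemma log_two_mul_factorial_le {n : ℕ} (hn : 5434 ≤ n) :
    log (2 * n * (n - 1) * n.factorial) ≤
      n * log ((0.37 * n - 2.63) * ((n - 1) / n)) := by
  have hx : (5434 : ℝ) ≤ n := by exact_mod_cast hn
  have hf := log_factorial_le (show 50 ≤ n by omega)
  have hfpos : (0 : ℝ) < n.factorial := by positivity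
  set x : ℝ := (n : ℝ) with hxdef
  have hx0 : 0 < x := by linarith
  have hl : log (2 * x * (x - 1) * n.factorial) ≤ log 2 + 2 * log x + log n.factorial := by
    have : log (x - 1) ≤ log x := log_le_log (by linarith) (by linarith)
    rw [log_mul (by nlinarith) hfpos.ne', log_mul (by positivity) (by linarith),
      log_mul (by norm_num) hx0.ne']
    linarith
  have ha : (263 / 37) / x < 1 := (div_lt_one hx0).2 (by linarith)
  have hb : 1 / x < 1 := (div_lt_one hx0).2 (by linarith)
  have hr : (0.37 * x - 2.63) * ((x - 1) / x) =
      x * 0.37 * (1 - (263 / 37) / x) * (1 - 1 / x) := by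
    field_simp
    ring
  have hr2 : log ((0.37 * x - 2.63) * ((x - 1) / x)) =
      log x + log 0.37 + log (1 - (263 / 37) / x) + log (1 - 1 / x) := by
    rw [hr, log_mul (mul_pos (by positivity) (by linarith)).ne' (by linarith),
      log_mul (by positivity) (by linarith), log_mul hx0.ne' (by norm_num)]
  have h1 := neg_le_mul_log_one_sub_div (b := 263 / 37) (by norm_num) (by norm_num) hx
  have h2 := neg_le_mul_log_one_sub_div (b := 1) (by norm_num) (by norm_num) hx
  have h3 : log x ≤ log 5434 + (x / 5434 - 1) := by
    have := log_le_sub_one_of_pos (show 0 < x / 5434 by positivity)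
    rw [log_div hx0.ne' (by norm_num)] at this
    linarith
  have h4 := mul_le_mul_of_nonneg_left log_const_ge hx0.le
  have h5 := log_const_le
  rw [hr2]
  norm_num at h1 h2 h4 h5 hf ⊢
  nlinarith

lemma edgeMultisetBound_le {k : ℕ} (hk : 5435 ≤ k) :
    (edgeMultisetBound k : ℝ) ≤ 0.37 * (k : ℝ) := by
  obtain ⟨n, rfl⟩ : ∃ n, k = n + 1 := ⟨k - 1, by omega⟩
  have hn : 5434 ≤ n := by omega
  have hx : (5434 : ℝ) ≤ n := by exact_mod_cast hn
  have hlog := log_two_mul_factorial_le hn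
  have e1 : ((n + 1 : ℕ) : ℝ) - 1 = n := by push_cast; ring
  have e2 : ((n + 1 : ℕ) : ℝ) - 2 = n - 1 := by push_cast; ring
  rw [edgeMultisetBound, e1, e2, Nat.add_sub_cancel]
  have hfpos : (0 : ℝ) < n.factorial := by positivity
  set x : ℝ := (n : ℝ) with hxdef
  have hx0 : 0 < x := by linarith
  have hx1 : 0 < x - 1 := by linarith
  have hP : 0 < 2 * x * (x - 1) * n.factorial := by positivity
  have hQ : 0 < (0.37 * x - 2.63) * ((x - 1) / x) :=
    mul_pos (by linarith) (by positivity)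
  have hroot : (2 * x * (x - 1) * n.factorial) ^ (1 / x) ≤
      (0.37 * x - 2.63) * ((x - 1) / x) := by
    rw [rpow_def_of_pos hP, ← le_log_iff_exp_le hQ, mul_one_div, div_le_iff₀ hx0]
    linarith
  have hmul := mul_le_mul_of_nonneg_left hroot (show 0 ≤ x / (x - 1) by positivity)
  have e3 : x / (x - 1) * ((0.37 * x - 2.63) * ((x - 1) / x)) = 0.37 * x - 2.63 := by
    field_simp
  rw [e3] at hmul
  refine (Nat.ceil_lt_add_one (by positivity)).le.trans ?_
  push_cast
  linarith

end Asymptotics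

section Graph

open Finset

variable {V : Type*} [Fintype V] [DecidableEq V] (G : SimpleGraph V) [DecidableRel G.Adj]

/-- The edges at the initial vertex of a dart other than the edge of the dart itself. -/
def otherEdges (d : G.Dart) : Finset (Sym2 V) :=
  (G.incidenceFinset d.fst).erase d.edge

variable {G}

lemma dart_edge_mem_incidenceFinset_fst (d : G.Dart) : d.edge ∈ G.incidenceFinset d.fst := by
  rw [SimpleGraph.mem_incidenceFinset]
  exact ⟨d.edge_mem, Sym2.mem_mk_left _ _⟩

lemma card_otherEdges {k : ℕ} (hreg : G.IsRegularOfDegree k) (d : G.Dart) :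
    #(otherEdges G d) = k - 1 := by
  rw [otherEdges, card_erase_of_mem (dart_edge_mem_incidenceFinset_fst d),
    G.card_incidenceFinset_eq_degree, hreg.degree_eq]

lemma disjoint_otherEdges (d : G.Dart) :
    Disjoint (otherEdges G d) (otherEdges G d.symm) := by
  refine disjoint_left.2 fun e he he' => ?_
  simp only [otherEdges, mem_erase, SimpleGraph.mem_incidenceFinset] at he he'
  exact he.1 ((Sym2.mem_and_mem_iff d.fst_ne_snd).1 ⟨he.2.2, he'.2.2⟩)

lemma card_otherEdges_containing_le {k : ℕ} (hreg : G.IsRegularOfDegree k) (e : Sym2 V) :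
    #{d : G.Dart | e ∈ otherEdges G d} ≤ 2 * (k - 1) := by
  induction e using Sym2.ind with
  | _ x y =>
  by_cases hxy : G.Adj x y
  · rw [← card_image_of_injective _ (SimpleGraph.Dart.toProd_injective (G := G))]
    have hsub : ({d : G.Dart | s(x, y) ∈ otherEdges G d} : Finset _).image
        SimpleGraph.Dart.toProd ⊆ {x} ×ˢ (G.neighborFinset x).erase y ∪
          {y} ×ˢ (G.neighborFinset y).erase x := by
      intro p hp
      obtain ⟨⟨⟨u, v⟩, huv⟩, hd, rfl⟩ := mem_image.1 hp
      simp only [otherEdges, mem_filter, mem_univ, true_and, mem_erase,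
        SimpleGraph.mem_incidenceFinset, SimpleGraph.Dart.edge_mk] at hd
      obtain ⟨hne, -, hu⟩ := hd
      rcases Sym2.mem_iff.1 hu with rfl | rfl
      · refine mem_union_left _ (mem_product.2 ⟨mem_singleton_self _, mem_erase.2 ⟨?_, ?_⟩⟩)
        · rintro rfl
          exact hne rfl
        · simpa using huv
      · refine mem_union_right _ (mem_product.2 ⟨mem_singleton_self _, mem_erase.2 ⟨?_, ?_⟩⟩)
        · rintro rfl
          exact hne Sym2.eq_swap
        · simpa using huv
    refine (card_le_card hsub).trans ((card_union_le _ _).trans ?_)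
    rw [card_product, card_product, card_erase_of_mem (by simpa using hxy),
      card_erase_of_mem (by simpa using hxy.symm), G.card_neighborFinset_eq_degree,
      G.card_neighborFinset_eq_degree, hreg.degree_eq, hreg.degree_eq, card_singleton,
      card_singleton]
    omega
  · rw [filter_false_of_mem]
    · simp
    · intro d _ hd
      simp only [otherEdges, mem_erase, SimpleGraph.mem_incidenceFinset] at hd
      exact hxy hd.2.1

lemma map_incidenceFinset_eq_cons (μ : Sym2 V → ℕ) (d : G.Dart) :
    Multiset.map μ (G.incidenceFinset d.fst).val =
      μ d.edge ::ₘ Multiset.map μ (otherEdges G d).val := by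
  rw [← Multiset.map_cons, otherEdges, ← insert_val_of_notMem (notMem_erase _ _),
    insert_erase (dart_edge_mem_incidenceFinset_fst d)]

end Graph

lemma exists_growth_factor {k : ℕ} (hk : 3 ≤ k) :
    ∃ β : ℝ, 0 < β ∧ β + (2 * (k - 1) : ℕ) * (k - 2 + 1).factorial / β ^ (k - 2) ≤
      edgeMultisetBound k := by
  obtain ⟨m, rfl⟩ : ∃ m, k = m + 2 := ⟨k - 2, by omega⟩
  have hm : (0 : ℝ) < m := by exact_mod_cast (by omega : 0 < m)
  have e1 : ((m + 2 : ℕ) : ℝ) - 1 = (m + 1 : ℕ) := by push_cast; ring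
  have e2 : ((m + 2 : ℕ) : ℝ) - 2 = m := by push_cast; ring
  have e3 : m + 2 - 1 = m + 1 := rfl
  have e4 : m + 2 - 2 = m := rfl
  rw [edgeMultisetBound, e1, e2, e3, e4]
  set P : ℝ := 2 * (m + 1 : ℕ) * m * (m + 1).factorial with hP
  have hP0 : 0 < P := by positivity
  set β : ℝ := P ^ (1 / ((m + 1 : ℕ) : ℝ)) with hβ
  have hβ0 : 0 < β := Real.rpow_pos_of_pos hP0 _
  have hpow : β ^ (m + 1) = P := by
    rw [hβ, one_div]
    exact Real.rpow_inv_natCast_pow hP0.le (by omega)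
  refine ⟨β, hβ0, ?_⟩
  have hdiv : ((2 * (m + 1) : ℕ) : ℝ) * (m + 1).factorial / β ^ m = β / m := by
    rw [div_eq_div_iff (by positivity) hm.ne', ← pow_succ', hpow, hP]
    push_cast
    ring
  rw [hdiv]
  refine le_trans ?_ (Nat.le_ceil _)
  have : ((m + 1 : ℕ) : ℝ) / m * β = β + β / m := by
    push_cast
    field_simp
  rw [this]
  linarith

end EdgeMultiset

/-- For a `k`-regular graph `G` (`k ≥ 3`) whose every edge has a list of at least
`⌈2 + (k-1)/(k-2) (2(k-1)(k-2)(k-1)!)^{1/(k-1)}⌉` labels, there is a list edge labeling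
distinguishing neighbors by multisets; moreover for `k ≥ 5435` this bound is at most
`0.37 k`. -/
theorem exists_list_edge_labeling_distinguishing_by_multisets
    {V : Type} [Fintype V] [DecidableEq V]
    (G : SimpleGraph V) [DecidableRel G.Adj] (k : ℕ) (hk : 3 ≤ k)
    (hreg : G.IsRegularOfDegree k)
    (L : Sym2 V → Finset ℕ)
    (hL : ∀ e ∈ G.edgeFinset, edgeMultisetBound k ≤ (L e).card) :
    (∃ μ : Sym2 V → ℕ, (∀ e ∈ G.edgeFinset, μ e ∈ L e) ∧
      ∀ u v : V, G.Adj u v →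
        Multiset.map μ (G.incidenceFinset u).val ≠
          Multiset.map μ (G.incidenceFinset v).val) ∧
    (5435 ≤ k → (edgeMultisetBound k : ℝ) ≤ 0.37 * (k : ℝ)) := by
  refine ⟨?_, EdgeMultiset.edgeMultisetBound_le⟩
  obtain ⟨β, hβ, hβℓ⟩ := EdgeMultiset.exists_growth_factor hk
  obtain ⟨μ, hμ, hne⟩ := EdgeMultiset.exists_labeling_of_counting
    (L := fun e => if e ∈ G.edgeFinset then L e else Finset.range (edgeMultisetBound k))
    (A := EdgeMultiset.otherEdges G) (B := fun d => EdgeMultiset.otherEdges G d.symm)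
    (m := k - 2) (D := 2 * (k - 1)) (ℓ := edgeMultisetBound k) hβ
    (fun e => by
      by_cases he : e ∈ G.edgeFinset
      · simpa only [he, if_true] using hL e he
      · simp only [he, if_false, Finset.card_range, le_refl])
    (fun d => by
      rw [EdgeMultiset.card_otherEdges hreg]
      omega)
    EdgeMultiset.disjoint_otherEdges
    (fun d => ⟨d.symm, rfl, by rw [SimpleGraph.Dart.symm_symm]⟩)
    (EdgeMultiset.card_otherEdges_containing_le hreg) hβℓ
  refine ⟨μ, fun e he => by simpa only [he, if_true] using hμ e, fun u v huv heq => ?_⟩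
  let d : G.Dart := ⟨(u, v), huv⟩
  have hu := EdgeMultiset.map_incidenceFinset_eq_cons μ d
  have hv := EdgeMultiset.map_incidenceFinset_eq_cons μ d.symm
  rw [SimpleGraph.Dart.edge_symm] at hv
  exact hne d ((Multiset.cons_inj_right _).1 (hu.symm.trans (heq.trans hv)))
end

section
/- Let k ≥ 3 and let G be a k-regular graph in which every edge and every vertex is assigned a list of labels. If each list has at least ⌈2 + k/(k−1) · (2k(k−1)·k!)^{1/k}⌉ elements, then there exists a list total labeling of G distinguishing neighbors by multisets. Moreover, if k ≥ 5650, then this bound is at most 0.37·k. -/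
/-- The bound `⌈2 + k/(k-1) · (2k(k-1)·k!)^{1/k}⌉` on list sizes. -/
noncomputable def totalMultisetBound (k : ℕ) : ℕ :=
  ⌈(2 : ℝ) + ((k : ℝ) / ((k : ℝ) - 1)) *
    ((2 * (k : ℝ) * ((k : ℝ) - 1) * (Nat.factorial k : ℝ)) ^ ((1 : ℝ) / (k : ℝ)))⌉₊

section Counting

variable {X I : Type*}

/-- `f` avoids equality of the multisets of values on `A i` and on `B i`, for every `i` such that
both sets lie inside `S`. -/
def AvoidsWithin (A B : I → Finset X) (S : Finset X) (f : X → ℕ) : Prop :=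
  ∀ i, A i ⊆ S → B i ⊆ S → (A i).val.map f ≠ (B i).val.map f

theorem AvoidsWithin.congr {A B : I → Finset X} {S T : Finset X} {f g : X → ℕ}
    (hf : AvoidsWithin A B S f) (hTS : T ⊆ S) (hfg : ∀ x ∈ T, g x = f x) :
    AvoidsWithin A B T g := by
  intro i hA hB
  rw [Multiset.map_congr rfl fun x hx => hfg x (hA hx),
    Multiset.map_congr rfl fun x hx => hfg x (hB hx)]
  exact hf i (hA.trans hTS) (hB.trans hTS)

variable [DecidableEq X]

/-- At most `(#A)!` functions agree outside `A` and have a prescribed multiset of values on `A`. -/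
theorem card_le_factorial_of_map_eq (A : Finset X) (m : Multiset ℕ) (s : Finset (X → ℕ))
    (hm : ∀ f ∈ s, A.val.map f = m) (hs : ∀ f ∈ s, ∀ g ∈ s, ∀ x ∉ A, f x = g x) :
    s.card ≤ A.card.factorial := by
  rcases s.eq_empty_or_nonempty with rfl | ⟨f₀, hf₀⟩
  · simp
  have hcard : m.toList.permutations.length = A.card.factorial := by
    rw [List.length_permutations, Multiset.length_toList, ← hm f₀ hf₀, Multiset.card_map,
      Finset.card_val]
  rw [← hcard]
  refine le_trans (Finset.card_le_card_of_injOn (fun f => A.toList.map f)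
    (t := m.toList.permutations.toFinset) ?_ ?_) (List.toFinset_card_le _)
  · intro f hf
    simp only [List.coe_toFinset, Set.mem_ofPred_eq, List.mem_permutations]
    rw [← Multiset.coe_eq_coe, ← Multiset.map_coe, Finset.coe_toList, Multiset.coe_toList,
      hm f hf]
  · intro f hf g hg hfg
    ext x
    by_cases hx : x ∈ A
    · exact List.map_inj_left.1 hfg x (Finset.mem_toList.2 hx)
    · exact hs f hf g hg x hx

/-- If adding one element multiplies `c` by at least `β`, then adding `#D` elements multiplies it
by at least `β ^ #D`. -/
theorem pow_card_mul_le_of_forall_ssubset {c : Finset X → ℝ} {β : ℝ} (hβ : 0 ≤ β) (S : Finset X)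
    (h : ∀ T ⊂ S, ∀ x ∉ T, β * c T ≤ c (insert x T)) (T D : Finset X) (hTD : Disjoint T D)
    (hS : T ∪ D ⊆ S) : β ^ D.card * c T ≤ c (T ∪ D) := by
  induction D using Finset.induction_on with
  | empty => simp
  | insert a D ha ih =>
    rw [Finset.disjoint_insert_right] at hTD
    rw [Finset.union_insert] at hS ⊢
    have haTD : a ∉ T ∪ D := by simp [hTD.1, ha]
    have hss : T ∪ D ⊂ S := (Finset.ssubset_insert haTD).trans_subset hS
    have := h _ hss a haTD
    rw [Finset.card_insert_of_notMem ha, pow_succ']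
    have ih' := ih hTD.2 hss.subset
    calc β * β ^ D.card * c T = β * (β ^ D.card * c T) := by ring
      _ ≤ β * c (T ∪ D) := by gcongr
      _ ≤ _ := this

open Classical in
/-- The choices from the lists `L` on `S`, extended by `0` outside `S`, that avoid all equalities
within `S`. -/
noncomputable def partialChoices [Fintype X] (A B : I → Finset X) (L : X → Finset ℕ)
    (S : Finset X) : Finset (X → ℕ) :=
  (Fintype.piFinset fun x => if x ∈ S then L x else {0}).filter (AvoidsWithin A B S)

theorem mem_partialChoices [Fintype X] {A B : I → Finset X} {L : X → Finset ℕ}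
    {S : Finset X} {f : X → ℕ} :
    f ∈ partialChoices A B L S ↔
      (∀ x ∈ S, f x ∈ L x) ∧ (∀ x ∉ S, f x = 0) ∧ AvoidsWithin A B S f := by
  simp only [partialChoices, Finset.mem_filter, Fintype.mem_piFinset, ← and_assoc]
  refine and_congr_left fun _ => ⟨fun h => ⟨fun x hx => by simpa [hx] using h x,
    fun x hx => by simpa [hx] using h x⟩, fun h x => ?_⟩
  by_cases hx : x ∈ S
  · simpa [hx] using h.1 x hx
  · simpa [hx] using h.2 x hx

variable [Fintype X] [Fintype I]

theorem card_mul_card_partialChoices_le (A B : I → Finset X) (L : X → Finset ℕ) (k : ℕ)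
    (hA : ∀ i, (A i).card = k) (hdisj : ∀ i, Disjoint (A i) (B i))
    (hsymm : ∀ i, ∃ j, A j = B i ∧ B j = A i) (S : Finset X) (x : X) (hx : x ∉ S) :
    (L x).card * (partialChoices A B L S).card ≤ (partialChoices A B L (insert x S)).card +
      ∑ i with x ∈ A i ∧ A i ⊆ insert x S,
        k.factorial * (partialChoices A B L (insert x S \ A i)).card := by
  classical
  set E : Finset (X → ℕ) := (L x ×ˢ partialChoices A B L S).image
    fun p => Function.update p.2 x p.1 with hE
  have hEcard : E.card = (L x).card * (partialChoices A B L S).card := by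
    rw [hE, Finset.card_image_of_injOn, Finset.card_product]
    rintro ⟨a, f⟩ hf ⟨b, g⟩ hg hfg
    simp only [Finset.coe_product, Set.mem_prod, Finset.mem_coe, mem_partialChoices] at hf hg
    have h1 := congrFun hfg x
    simp only [Function.update_self] at h1
    refine Prod.ext h1 (funext fun y => ?_)
    by_cases hy : y = x
    · subst hy
      exact (hf.2.2.1 y hx).trans (hg.2.2.1 y hx).symm
    · simpa [Function.update_of_ne hy] using congrFun hfg y
  have hEmem : ∀ f ∈ E, (∀ y ∈ insert x S, f y ∈ L y) ∧ (∀ y ∉ insert x S, f y = 0) ∧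
      AvoidsWithin A B S f := by
    intro f hf
    obtain ⟨⟨a, g⟩, hp, rfl⟩ := Finset.mem_image.1 hf
    simp only [Finset.mem_product, mem_partialChoices] at hp
    obtain ⟨ha, hg1, hg2, hg3⟩ := hp
    have hne : ∀ y ∈ S, y ≠ x := fun y hy h => hx (h ▸ hy)
    refine ⟨fun y hy => ?_, fun y hy => ?_, hg3.congr subset_rfl fun y hy => ?_⟩
    · rcases Finset.mem_insert.1 hy with rfl | hy
      · simpa using ha
      · simpa [Function.update_of_ne (hne y hy)] using hg1 y hy
    · rw [Finset.mem_insert, not_or] at hy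
      simpa [Function.update_of_ne hy.1] using hg2 y hy.2
    · simp [Function.update_of_ne (hne y hy)]
  let bad : I → Finset (X → ℕ) := fun i =>
    E.filter fun f => B i ⊆ insert x S ∧ (A i).val.map f = (B i).val.map f
  have hcover : E ⊆ partialChoices A B L (insert x S) ∪
      (Finset.univ.filter fun i => x ∈ A i ∧ A i ⊆ insert x S).biUnion bad := by
    intro f hf
    obtain ⟨h1, h2, h3⟩ := hEmem f hf
    by_cases hav : AvoidsWithin A B (insert x S) f
    · exact Finset.mem_union_left _ (mem_partialChoices.2 ⟨h1, h2, hav⟩)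
    · refine Finset.mem_union_right _ ?_
      simp only [AvoidsWithin, not_forall, not_not] at hav
      obtain ⟨i, hiA, hiB, hi⟩ := hav
      simp only [Finset.mem_biUnion, bad, Finset.mem_filter, Finset.mem_univ, true_and]
      by_cases hxA : x ∈ A i
      · exact ⟨i, ⟨hxA, hiA⟩, hf, hiB, hi⟩
      by_cases hxB : x ∈ B i
      · obtain ⟨j, hj1, hj2⟩ := hsymm i
        exact ⟨j, ⟨hj1 ▸ hxB, hj1 ▸ hiB⟩, hf, hj2 ▸ hiA, by rw [hj1, hj2, hi]⟩
      · exact absurd hi (h3 i ((Finset.subset_insert_iff_of_notMem hxA).1 hiA)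
          ((Finset.subset_insert_iff_of_notMem hxB).1 hiB))
  have hbad : ∀ i, x ∈ A i →
      (bad i).card ≤ k.factorial * (partialChoices A B L (insert x S \ A i)).card := by
    intro i hxi
    refine Finset.card_le_mul_card_image_of_maps_to
      (f := fun f y => if y ∈ A i then 0 else f y) (fun f hf => ?_) _ (fun g hg => ?_)
    · obtain ⟨h1, h2, h3⟩ := hEmem f (Finset.mem_filter.1 hf).1
      refine mem_partialChoices.2 ⟨fun y hy => ?_, fun y hy => ?_, ?_⟩
      · rw [Finset.mem_sdiff] at hy
        simpa [hy.2] using h1 y hy.1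
      · rw [Finset.mem_sdiff, not_and_not_right] at hy
        by_cases hyA : y ∈ A i
        · simp [hyA]
        · simpa [hyA] using h2 y (mt hy hyA)
      · refine h3.congr (fun y hy => ?_) (fun y hy => by simp [(Finset.mem_sdiff.1 hy).2])
        rw [Finset.mem_sdiff] at hy
        rcases Finset.mem_insert.1 hy.1 with rfl | h
        · exact absurd hxi hy.2
        · exact h
    · rw [← hA i]
      have hval : ∀ f ∈ (bad i).filter (fun f => (fun y => if y ∈ A i then 0 else f y) = g),
          ∀ y ∉ A i, f y = g y := by
        intro f hf y hy
        rw [← (Finset.mem_filter.1 hf).2]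
        simp [hy]
      refine card_le_factorial_of_map_eq (A i) ((B i).val.map g) _ (fun f hf => ?_)
        (fun f hf f' hf' y hy => by rw [hval f hf y hy, hval f' hf' y hy])
      rw [(Finset.mem_filter.1 (Finset.mem_filter.1 hf).1).2.2]
      exact Multiset.map_congr rfl fun y hy =>
        hval f hf y (Finset.disjoint_right.1 (hdisj i) hy)
  calc (L x).card * (partialChoices A B L S).card = E.card := hEcard.symm
    _ ≤ _ := Finset.card_le_card hcover
    _ ≤ _ := Finset.card_union_le _ _
    _ ≤ _ := by
      gcongr
      exact Finset.card_biUnion_le.trans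
        (Finset.sum_le_sum fun i hi => hbad i (Finset.mem_filter.1 hi).2.1)

theorem mul_card_partialChoices_le_card_insert (A B : I → Finset X) (L : X → Finset ℕ) (k d : ℕ)
    (β : ℝ) (hβ : 0 < β) (hA : ∀ i, (A i).card = k) (hdisj : ∀ i, Disjoint (A i) (B i))
    (hsymm : ∀ i, ∃ j, A j = B i ∧ B j = A i)
    (hdeg : ∀ x, (Finset.univ.filter fun i => x ∈ A i).card ≤ d)
    (hL : ∀ x, β + d * k.factorial / β ^ (k - 1) ≤ (L x).card) (S : Finset X) :
    ∀ x ∉ S, β * (partialChoices A B L S).card ≤ (partialChoices A B L (insert x S)).card := by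
  induction S using Finset.strongInduction with
  | H S ih =>
  intro x hx
  set c : Finset X → ℝ := fun T => ((partialChoices A B L T).card : ℝ) with hc
  have hstep := card_mul_card_partialChoices_le A B L k hA hdisj hsymm S x hx
  have hterm : ∀ i, x ∈ A i → A i ⊆ insert x S →
      c (insert x S \ A i) ≤ c S / β ^ (k - 1) := by
    intro i hxi hi
    rw [le_div_iff₀ (by positivity), mul_comm]
    have hunion : (insert x S \ A i) ∪ (A i).erase x = S := by
      ext y
      have := @hi y
      by_cases hyx : y = x
      · subst hyx
        simp [hxi, hx]
      · by_cases hyA : y ∈ A i <;> simp_all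
    have := pow_card_mul_le_of_forall_ssubset (c := c) hβ.le S ih (insert x S \ A i)
      ((A i).erase x) (Finset.sdiff_disjoint.mono_right (Finset.erase_subset _ _)) hunion.subset
    rwa [hunion, Finset.card_erase_of_mem hxi, hA] at this
  have hsum : ∑ i with x ∈ A i ∧ A i ⊆ insert x S, (k.factorial : ℝ) * c (insert x S \ A i) ≤
      d * (k.factorial * (c S / β ^ (k - 1))) := by
    calc _ ≤ ∑ i with x ∈ A i ∧ A i ⊆ insert x S, (k.factorial : ℝ) * (c S / β ^ (k - 1)) := by
          refine Finset.sum_le_sum fun i hi => ?_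
          have hi' := (Finset.mem_filter.1 hi).2
          gcongr
          exact hterm i hi'.1 hi'.2
      _ = ((Finset.univ.filter fun i => x ∈ A i ∧ A i ⊆ insert x S).card : ℝ) *
            (k.factorial * (c S / β ^ (k - 1))) := by
          rw [Finset.sum_const, nsmul_eq_mul]
      _ ≤ _ := by
          gcongr
          exact (Finset.card_le_card (Finset.monotone_filter_right _ fun i _ h => h.1)).trans
            (hdeg x)
  have hstep' : ((L x).card : ℝ) * c S ≤ c (insert x S) +
      ∑ i with x ∈ A i ∧ A i ⊆ insert x S, (k.factorial : ℝ) * c (insert x S \ A i) := by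
    simp only [hc]
    exact_mod_cast hstep
  have hLx := mul_le_mul_of_nonneg_right (hL x) (Nat.cast_nonneg (partialChoices A B L S).card)
  have hcS : (β + d * k.factorial / β ^ (k - 1)) * c S =
      β * c S + d * (k.factorial * (c S / β ^ (k - 1))) := by ring
  change β * c S ≤ c (insert x S)
  change _ ≤ ((L x).card : ℝ) * c S at hLx
  linarith

theorem exists_choice_map_ne (A B : I → Finset X) (L : X → Finset ℕ) (k d : ℕ)
    (β : ℝ) (hβ : 0 < β) (hk : 0 < k) (hA : ∀ i, (A i).card = k)
    (hdisj : ∀ i, Disjoint (A i) (B i)) (hsymm : ∀ i, ∃ j, A j = B i ∧ B j = A i)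
    (hdeg : ∀ x, (Finset.univ.filter fun i => x ∈ A i).card ≤ d)
    (hL : ∀ x, β + d * k.factorial / β ^ (k - 1) ≤ (L x).card) :
    ∃ f : X → ℕ, (∀ x, f x ∈ L x) ∧ ∀ i, (A i).val.map f ≠ (B i).val.map f := by
  have h := pow_card_mul_le_of_forall_ssubset hβ.le Finset.univ
    (c := fun T => ((partialChoices A B L T).card : ℝ))
    (fun T _ => mul_card_partialChoices_le_card_insert A B L k d β hβ hA hdisj hsymm hdeg hL T)
    ∅ Finset.univ (Finset.disjoint_empty_left _) (by simp)
  have h0 : 0 < (partialChoices A B L ∅).card := by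
    refine Finset.card_pos.2 ⟨fun _ => 0, mem_partialChoices.2 ⟨by simp, by simp, ?_⟩⟩
    intro i hi
    have := hA i
    rw [Finset.subset_empty.1 hi] at this
    simp at this
    omega
  rw [Finset.empty_union] at h
  have hpos : (0 : ℝ) < (partialChoices A B L Finset.univ).card := by
    refine lt_of_lt_of_le ?_ h
    positivity
  obtain ⟨f, hf⟩ := Finset.card_pos.1 (Nat.cast_pos.1 hpos)
  rw [mem_partialChoices] at hf
  exact ⟨f, fun x => hf.1 x (Finset.mem_univ x), fun i =>
    hf.2.2 i (Finset.subset_univ _) (Finset.subset_univ _)⟩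

end Counting

theorem log_factorial_le (n : ℕ) (hn : 1 ≤ n) :
    Real.log n.factorial ≤ 1 + Real.log n / 2 + n * Real.log n - n := by
  obtain ⟨m, rfl⟩ := Nat.exists_eq_add_of_le' hn
  have h := Stirling.log_stirlingSeq'_antitone (Nat.zero_le m)
  simp only [Function.comp, Nat.succ_eq_add_one, zero_add, Stirling.stirlingSeq_one] at h
  rw [Stirling.log_stirlingSeq_formula, Real.log_div (Real.exp_pos 1).ne' (by positivity),
    Real.log_div (by positivity) (Real.exp_pos 1).ne', Real.log_exp,
    Real.log_mul (by norm_num) (by positivity), Real.log_sqrt (by norm_num)] at h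
  linarith

theorem neg_div_one_sub_le_log_one_sub {y : ℝ} (h : y < 1) :
    -(y / (1 - y)) ≤ Real.log (1 - y) := by
  have h' := Real.one_sub_inv_le_log_of_pos (sub_pos.2 h)
  have : -(y / (1 - y)) = 1 - (1 - y)⁻¹ := by
    have : 1 - y ≠ 0 := (sub_pos.2 h).ne'
    field_simp
    ring
  linarith

theorem log_le_add_div_sub_one {x : ℝ} (hx : 5650 ≤ x) :
    Real.log x ≤ 8.6401 + (x / 5650 - 1) := by
  have h1 : Real.log (x / 5650) ≤ x / 5650 - 1 := Real.log_le_sub_one_of_pos (by positivity)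
  rw [Real.log_div (by positivity) (by norm_num)] at h1
  have h2 : Real.log ((5650 : ℝ) ^ 2 / 2 ^ 25) ≤ (5650 : ℝ) ^ 2 / 2 ^ 25 - 1 :=
    Real.log_le_sub_one_of_pos (by positivity)
  rw [Real.log_div (by positivity) (by norm_num), Real.log_pow, Real.log_pow] at h2
  have := Real.log_two_lt_d9
  norm_num at h2 ⊢
  linarith

theorem le_one_add_log : (0.005747 : ℝ) ≤ 1 + Real.log 0.37 := by
  have h := Real.le_log_one_add_of_nonneg (x := 0.005764) (by norm_num)
  have h2 : Real.log (1 + 0.005764) ≤ Real.log (0.37 * Real.exp 1) :=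
    Real.log_le_log (by norm_num) (by linarith [Real.exp_one_gt_d9])
  rw [Real.log_mul (by norm_num) (by positivity), Real.log_exp] at h2
  norm_num at h h2 ⊢
  linarith

theorem totalMultisetBound_le (k : ℕ) (hk : 5650 ≤ k) :
    (totalMultisetBound k : ℝ) ≤ 0.37 * (k : ℝ) := by
  have hx : (5650 : ℝ) ≤ k := by exact_mod_cast hk
  have hfac := log_factorial_le k (by omega)
  have hfpos : (0 : ℝ) < k.factorial := by exact_mod_cast k.factorial_pos
  unfold totalMultisetBound
  generalize (k.factorial : ℝ) = F at *
  generalize (k : ℝ) = x at *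
  have hx0 : 0 < x := by linarith
  have hx1 : 0 < x - 1 := by linarith
  have hY : 0 < 2 * x * (x - 1) * F := by positivity
  set Y := 2 * x * (x - 1) * F with hYdef
  have hZ : 0 < (0.37 * x - 3) * ((x - 1) / x) :=
    mul_pos (by norm_num; linarith) (by positivity)
  have hlog : Real.log Y ≤ x * Real.log ((0.37 * x - 3) * ((x - 1) / x)) := by
    have e1 : (0.37 * x - 3) * ((x - 1) / x) = 0.37 * x * (1 - 300 / (37 * x)) * (1 - 1 / x) := by
      field_simp
      ring
    have hs1 : 300 / (37 * x) ≤ 0.001436 := by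
      rw [div_le_iff₀ (by positivity)]; norm_num; linarith
    have hs2 : 1 / x ≤ 0.000177 := by
      rw [div_le_iff₀ (by positivity)]; norm_num; linarith
    have hp1 : 0 < 1 - 300 / (37 * x) := by norm_num at hs1 ⊢; linarith
    have hp2 : 0 < 1 - 1 / x := by norm_num at hs2 ⊢; linarith
    rw [e1, Real.log_mul (by positivity) hp2.ne', Real.log_mul (by positivity) hp1.ne',
      Real.log_mul (by norm_num) hx0.ne', hYdef, Real.log_mul (by positivity) hfpos.ne',
      Real.log_mul (by positivity) hx1.ne', Real.log_mul (by norm_num) hx0.ne']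
    have hl1 : Real.log (x - 1) ≤ Real.log x := Real.log_le_log hx1 (by linarith)
    have hl2 := log_le_add_div_sub_one hx
    have h37 := mul_le_mul_of_nonneg_left le_one_add_log hx0.le
    have ha : -8.1198 ≤ x * Real.log (1 - 300 / (37 * x)) := by
      refine le_trans ?_ (mul_le_mul_of_nonneg_left
        (neg_div_one_sub_le_log_one_sub (sub_pos.1 hp1)) hx0.le)
      have : x * -(300 / (37 * x) / (1 - 300 / (37 * x))) =
          -(300 / 37 / (1 - 300 / (37 * x))) := by field_simp
      rw [this]
      norm_num only at hs1 ⊢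
      rw [neg_le_neg_iff, div_le_iff₀ hp1]
      linarith
    have hb : -1.0002 ≤ x * Real.log (1 - 1 / x) := by
      refine le_trans ?_ (mul_le_mul_of_nonneg_left
        (neg_div_one_sub_le_log_one_sub (sub_pos.1 hp2)) hx0.le)
      have : x * -(1 / x / (1 - 1 / x)) = -(1 / (1 - 1 / x)) := by field_simp
      rw [this]
      norm_num only at hs2 ⊢
      rw [neg_le_neg_iff, div_le_iff₀ hp2]
      linarith
    have := Real.log_two_lt_d9
    norm_num only at *
    linarith
  have hroot : Y ^ (1 / x) ≤ (0.37 * x - 3) * ((x - 1) / x) := by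
    rw [Real.rpow_def_of_pos hY, ← Real.le_log_iff_exp_le hZ, mul_one_div, div_le_iff₀ hx0]
    linarith
  have hprod : x / (x - 1) * Y ^ (1 / x) ≤ 0.37 * x - 3 := by
    calc _ ≤ x / (x - 1) * ((0.37 * x - 3) * ((x - 1) / x)) := by gcongr
      _ = _ := by field_simp
  have hnn : 0 ≤ x / (x - 1) * Y ^ (1 / x) := by positivity
  linarith [Nat.ceil_lt_add_one (a := 2 + x / (x - 1) * Y ^ (1 / x)) (by linarith)]

theorem add_div_pow_le_totalMultisetBound (k : ℕ) (hk : 3 ≤ k) : ∃ β : ℝ, 0 < β ∧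
    β + ((2 * (k - 1) : ℕ) : ℝ) * k.factorial / β ^ (k - 1) ≤ totalMultisetBound k := by
  have hk' : (3 : ℝ) ≤ k := by exact_mod_cast hk
  have hf : (0 : ℝ) < k.factorial := by exact_mod_cast k.factorial_pos
  have h1 : (0 : ℝ) < (k : ℝ) - 1 := by linarith
  set Y : ℝ := 2 * (k : ℝ) * ((k : ℝ) - 1) * k.factorial with hY
  have hYpos : 0 < Y := by positivity
  refine ⟨Y ^ ((1 : ℝ) / k), by positivity, ?_⟩
  set β := Y ^ ((1 : ℝ) / k) with hβ
  have hβpos : 0 < β := by positivity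
  have hpow : β ^ (k - 1) * β = Y := by
    rw [← pow_succ, Nat.sub_add_cancel (by omega), hβ, one_div,
      Real.rpow_inv_natCast_pow hYpos.le (by omega)]
  have hle : 2 + (k : ℝ) / ((k : ℝ) - 1) * β ≤ totalMultisetBound k := Nat.le_ceil _
  have hcast : ((2 * (k - 1) : ℕ) : ℝ) = 2 * ((k : ℝ) - 1) := by
    push_cast [Nat.cast_sub (show 1 ≤ k by omega)]
    ring
  have heq : 2 * ((k : ℝ) - 1) * k.factorial / β ^ (k - 1) = β / k := by
    rw [div_eq_div_iff (by positivity) (by positivity), mul_comm β, hpow, hY]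
    ring
  have hdiv : β / k ≤ β / ((k : ℝ) - 1) := by gcongr; linarith
  have hexp : (k : ℝ) / ((k : ℝ) - 1) * β = β + β / ((k : ℝ) - 1) := by
    field_simp
    ring
  rw [hcast, heq]
  linarith

section Graph

variable {V : Type*} [Fintype V] [DecidableEq V] (G : SimpleGraph V) [DecidableRel G.Adj]

/-- The vertex `u` together with the edges at `u` other than `s(u, v)`. -/
def starWithout (u v : V) : Finset (V ⊕ Sym2 V) :=
  Finset.disjSum {u} ((G.incidenceFinset u).erase s(u, v))

theorem mem_incidenceFinset_mk {u a b : V} :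
    s(a, b) ∈ G.incidenceFinset u ↔ G.Adj a b ∧ (u = a ∨ u = b) := by
  rw [SimpleGraph.mem_incidenceFinset, SimpleGraph.mk'_mem_incidenceSet_iff]

theorem card_starWithout {k : ℕ} (hreg : G.IsRegularOfDegree k) {u v : V} (h : G.Adj u v) :
    (starWithout G u v).card = k := by
  have hmem : s(u, v) ∈ G.incidenceFinset u := (mem_incidenceFinset_mk G).2 ⟨h, Or.inl rfl⟩
  have hpos : 0 < (G.incidenceFinset u).card := Finset.card_pos.2 ⟨_, hmem⟩
  rw [starWithout, Finset.card_disjSum, Finset.card_erase_of_mem hmem, Finset.card_singleton]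
  rw [G.card_incidenceFinset_eq_degree, hreg u] at *
  omega

theorem disjoint_starWithout {u v : V} (h : G.Adj u v) :
    Disjoint (starWithout G u v) (starWithout G v u) := by
  rw [Finset.disjoint_left]
  rintro (w | e) h1 h2
  · simp only [starWithout, Finset.inl_mem_disjSum, Finset.mem_singleton] at h1 h2
    exact h.ne (h1.symm.trans h2)
  · simp only [starWithout, Finset.inr_mem_disjSum, Finset.mem_erase] at h1 h2
    refine h1.1 ?_
    have hu : u ∈ e := (((G.mem_incidenceFinset u e).1 h1.2)).2
    have hv : v ∈ e := (((G.mem_incidenceFinset v e).1 h2.2)).2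
    exact (Sym2.mem_and_mem_iff h.ne).1 ⟨hu, hv⟩

theorem card_filter_mem_starWithout_le {k : ℕ} (hk : 2 ≤ k) (hreg : G.IsRegularOfDegree k)
    (x : V ⊕ Sym2 V) :
    (Finset.univ.filter fun p : {p : V × V // G.Adj p.1 p.2} =>
      x ∈ starWithout G p.1.1 p.1.2).card ≤ 2 * (k - 1) := by
  have key : ∀ t : Finset (V × V), t.card ≤ 2 * (k - 1) →
      (∀ u v, G.Adj u v → x ∈ starWithout G u v → (u, v) ∈ t) →
      (Finset.univ.filter fun p : {p : V × V // G.Adj p.1 p.2} =>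
        x ∈ starWithout G p.1.1 p.1.2).card ≤ 2 * (k - 1) := by
    intro t ht h
    refine (Finset.card_le_card_of_injOn Subtype.val (fun p hp => ?_)
      Subtype.val_injective.injOn).trans ht
    exact h _ _ p.2 (Finset.mem_filter.1 hp).2
  rcases x with w | e
  · refine key ({w} ×ˢ G.neighborFinset w) ?_ fun u v h hx => ?_
    · rw [Finset.card_product, Finset.card_singleton, G.card_neighborFinset_eq_degree, hreg w]
      omega
    · simp only [starWithout, Finset.inl_mem_disjSum, Finset.mem_singleton] at hx
      subst hx
      simpa using h
  · induction e with
    | _ a b =>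
    by_cases hab : G.Adj a b
    · refine key (({a} ×ˢ (G.neighborFinset a).erase b) ∪ ({b} ×ˢ (G.neighborFinset b).erase a))
        ((Finset.card_union_le _ _).trans ?_) fun u v h hx => ?_
      · rw [Finset.card_product, Finset.card_product, Finset.card_erase_of_mem (by simpa),
          Finset.card_erase_of_mem (by simpa using hab.symm), G.card_neighborFinset_eq_degree,
          G.card_neighborFinset_eq_degree, hreg a, hreg b]
        simp
        omega
      · simp only [starWithout, Finset.inr_mem_disjSum, Finset.mem_erase,
          mem_incidenceFinset_mk] at hx
        obtain ⟨hne, -, rfl | rfl⟩ := hx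
        · simp only [Finset.mem_union, Finset.mem_product, Finset.mem_singleton,
            Finset.mem_erase, SimpleGraph.mem_neighborFinset]
          exact Or.inl ⟨trivial, fun hvb => hne (by rw [hvb]), h⟩
        · simp only [Finset.mem_union, Finset.mem_product, Finset.mem_singleton,
            Finset.mem_erase, SimpleGraph.mem_neighborFinset]
          exact Or.inr ⟨trivial, fun hva => hne (by rw [hva, Sym2.eq_swap]), h⟩
    · refine key ∅ (by simp) fun u v h hx => ?_
      simp only [starWithout, Finset.inr_mem_disjSum, Finset.mem_erase,
        mem_incidenceFinset_mk] at hx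
      exact absurd hx.2.1 hab

theorem cons_map_incidenceFinset_eq {u v : V} (h : G.Adj u v) (f : V ⊕ Sym2 V → ℕ) :
    f (Sum.inl u) ::ₘ Multiset.map (fun e => f (Sum.inr e)) (G.incidenceFinset u).val =
      f (Sum.inr s(u, v)) ::ₘ (starWithout G u v).val.map f := by
  have hmem : s(u, v) ∈ G.incidenceFinset u := (mem_incidenceFinset_mk G).2 ⟨h, Or.inl rfl⟩
  have hval : (G.incidenceFinset u).val =
      s(u, v) ::ₘ ((G.incidenceFinset u).erase s(u, v)).val := by
    rw [Finset.erase_val, Multiset.cons_erase hmem]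
  rw [hval, starWithout, Finset.val_disjSum, Multiset.disjSum]
  simp [Multiset.cons_swap]

end Graph

/-- For a `k`-regular graph `G` (`k ≥ 3`) whose every edge and vertex has a list of at least
`⌈2 + k/(k-1) (2k(k-1)k!)^{1/k}⌉` labels, there is a list total labeling distinguishing
neighbors by multisets; moreover for `k ≥ 5650` this bound is at most `0.37 k`. -/
theorem exists_list_total_labeling_distinguishing_by_multisets
    {V : Type} [Fintype V] [DecidableEq V]
    (G : SimpleGraph V) [DecidableRel G.Adj] (k : ℕ) (hk : 3 ≤ k)
    (hreg : G.IsRegularOfDegree k)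
    (LV : V → Finset ℕ) (LE : Sym2 V → Finset ℕ)
    (hLV : ∀ v : V, totalMultisetBound k ≤ (LV v).card)
    (hLE : ∀ e ∈ G.edgeFinset, totalMultisetBound k ≤ (LE e).card) :
    (∃ (ηV : V → ℕ) (ηE : Sym2 V → ℕ),
      (∀ v : V, ηV v ∈ LV v) ∧ (∀ e ∈ G.edgeFinset, ηE e ∈ LE e) ∧
      ∀ u v : V, G.Adj u v →
        (ηV u) ::ₘ Multiset.map ηE (G.incidenceFinset u).val ≠
          (ηV v) ::ₘ Multiset.map ηE (G.incidenceFinset v).val) ∧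
    (5650 ≤ k → (totalMultisetBound k : ℝ) ≤ 0.37 * (k : ℝ)) := by
  refine ⟨?_, totalMultisetBound_le k⟩
  obtain ⟨β, hβ, hbound⟩ := add_div_pow_le_totalMultisetBound k hk
  let L : V ⊕ Sym2 V → Finset ℕ := Sum.elim LV fun e =>
    if e ∈ G.edgeFinset then LE e else Finset.range (totalMultisetBound k)
  have hL : ∀ x, totalMultisetBound k ≤ (L x).card := by
    rintro (v | e)
    · exact hLV v
    · by_cases he : e ∈ G.edgeFinset
      · simpa only [L, Sum.elim_inr, if_pos he] using hLE e he
      · simp only [L, Sum.elim_inr, if_neg he, Finset.card_range, le_refl]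
  obtain ⟨f, hfL, hf⟩ := exists_choice_map_ne
    (fun p : {p : V × V // G.Adj p.1 p.2} => starWithout G p.1.1 p.1.2)
    (fun p => starWithout G p.1.2 p.1.1) L k (2 * (k - 1)) β hβ (by omega)
    (fun p => card_starWithout G hreg p.2) (fun p => disjoint_starWithout G p.2)
    (fun p => ⟨⟨(p.1.2, p.1.1), p.2.symm⟩, rfl, rfl⟩)
    (card_filter_mem_starWithout_le G (by omega) hreg)
    (fun x => hbound.trans (by exact_mod_cast hL x))
  refine ⟨fun v => f (Sum.inl v), fun e => f (Sum.inr e), fun v => hfL (Sum.inl v),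
    fun e he => ?_, fun u v huv heq => ?_⟩
  · simpa only [L, Sum.elim_inr, if_pos he] using hfL (Sum.inr e)
  · rw [cons_map_incidenceFinset_eq G huv, cons_map_incidenceFinset_eq G huv.symm,
      Sym2.eq_swap (a := v), Multiset.cons_inj_right] at heq
    exact hf ⟨(u, v), huv⟩ heq
end

section
/- Consider a (v,b,k,r)-configuration with point set P and line set L, where k ≥ 3, and assume each point p ∈ P has a list of at least R colors. If R ≥ ⌈2 + (k−1)/(k−2) · (r(r−1)(k−1)(k−2)·(k−1)!)^{1/(k−1)}⌉, then for each point one can choose a color from its list so that no two lines that share a common point have the same multiset of colors. -/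
/-- The colorings `φ` of the points of `S` from the lists `L` (extended by `0` outside `S`) such that
distinct lines `ℓ₁`, `ℓ₂` through a point `p` with `ℓ₁ \ {p}`, `ℓ₂ \ {p}` inside `S` get different
multisets of colors on `ℓ₁ \ {p}` and `ℓ₂ \ {p}`. -/
def validColorings {Pt : Type} [Fintype Pt] [DecidableEq Pt] (Lines : Finset (Finset Pt))
    (L : Pt → Finset ℕ) (S : Finset Pt) : Finset (Pt → ℕ) :=
  (Fintype.piFinset fun p => if p ∈ S then L p else {0}).filter fun φ =>
    ∀ ℓ₁ ∈ Lines, ∀ ℓ₂ ∈ Lines, ∀ p ∈ ℓ₁ ∩ ℓ₂, ℓ₁ ≠ ℓ₂ → ℓ₁.erase p ⊆ S → ℓ₂.erase p ⊆ S →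
      Multiset.map φ (ℓ₁.erase p).val ≠ Multiset.map φ (ℓ₂.erase p).val

theorem pow_card_sdiff_mul_le {α : Type*} [DecidableEq α] {β : ℝ} (hβ : 0 ≤ β) (f : Finset α → ℝ)
    {S T : Finset α} (hTS : T ⊆ S)
    (h : ∀ (U : Finset α) (x : α), x ∉ U → insert x U ⊆ S → β * f U ≤ f (insert x U)) :
    β ^ (S \ T).card * f T ≤ f S := by
  have key : ∀ D : Finset α, D ⊆ S \ T → β ^ D.card * f T ≤ f (D ∪ T) := by
    intro D
    induction D using Finset.induction_on with
    | empty => simp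
    | insert x D hx ih =>
      intro hD
      have hxS := hD (Finset.mem_insert_self x D)
      rw [Finset.mem_sdiff] at hxS
      have hD' : D ⊆ S \ T := (Finset.subset_insert x D).trans hD
      have h1 := h (D ∪ T) x (by simp [hx, hxS.2]) (by
        intro y hy
        simp only [Finset.mem_insert, Finset.mem_union] at hy
        rcases hy with rfl | hy | hy
        · exact hxS.1
        · exact (Finset.mem_sdiff.1 (hD' hy)).1
        · exact hTS hy)
      rw [Finset.card_insert_of_notMem hx, Finset.insert_union]
      calc β ^ (D.card + 1) * f T = β * (β ^ D.card * f T) := by ring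
        _ ≤ β * f (D ∪ T) := mul_le_mul_of_nonneg_left (ih hD') hβ
        _ ≤ _ := h1
  simpa [Finset.sdiff_union_of_subset hTS] using key _ subset_rfl

/-- At most `|D|!` functions with prescribed values off `D` have a given multiset of values
on `D`. -/
theorem card_le_factorial_of_map_eq_s8 {α γ : Type*} [DecidableEq γ] (F : Finset (α → γ))
    (D : Finset α) (χ : α → γ) (M : Multiset γ) (hM : ∀ φ ∈ F, Multiset.map φ D.val = M)
    (hχ : ∀ φ ∈ F, ∀ q ∉ D, φ q = χ q) : F.card ≤ D.card.factorial := by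
  rcases F.eq_empty_or_nonempty with rfl | ⟨φ₀, h₀⟩
  · simp
  have hcoe : ∀ φ : α → γ, ((D.toList.map φ : List γ) : Multiset γ) = Multiset.map φ D.val := by
    intro φ
    rw [← Multiset.map_coe, Finset.coe_toList]
  calc F.card ≤ (D.toList.map φ₀).permutations.toFinset.card := by
        refine Finset.card_le_card_of_injOn (fun φ => D.toList.map φ) ?_ ?_
        · intro φ hφ
          simp only [List.coe_toFinset, Set.mem_ofPred_eq, List.mem_permutations]
          rw [← Multiset.coe_eq_coe, hcoe, hcoe, hM φ hφ, hM φ₀ h₀]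
        · intro φ hφ ψ hψ hφψ
          funext q
          by_cases hq : q ∈ D
          · exact List.map_inj_left.1 hφψ q (Finset.mem_toList.2 hq)
          · rw [hχ φ hφ q hq, hχ ψ hψ q hq]
    _ ≤ (D.toList.map φ₀).permutations.length := List.toFinset_card_le _
    _ = D.card.factorial := by
        rw [List.length_permutations, List.length_map, Finset.length_toList]

section Colorings

variable {Pt : Type} [Fintype Pt] [DecidableEq Pt] {Lines : Finset (Finset Pt)}
  {L : Pt → Finset ℕ}

theorem mem_validColorings {S : Finset Pt} {φ : Pt → ℕ} :
    φ ∈ validColorings Lines L S ↔ (∀ p, φ p ∈ if p ∈ S then L p else {0}) ∧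
      ∀ ℓ₁ ∈ Lines, ∀ ℓ₂ ∈ Lines, ∀ p ∈ ℓ₁ ∩ ℓ₂, ℓ₁ ≠ ℓ₂ → ℓ₁.erase p ⊆ S → ℓ₂.erase p ⊆ S →
        Multiset.map φ (ℓ₁.erase p).val ≠ Multiset.map φ (ℓ₂.erase p).val := by
  rw [validColorings, Finset.mem_filter, Fintype.mem_piFinset]

theorem restrict_mem_validColorings {S T : Finset Pt} (hTS : T ⊆ S) {φ : Pt → ℕ}
    (hφ : φ ∈ validColorings Lines L S) :
    (fun q => if q ∈ T then φ q else 0) ∈ validColorings Lines L T := by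
  rw [mem_validColorings] at hφ ⊢
  refine ⟨fun p => ?_, fun ℓ₁ h₁ ℓ₂ h₂ p hp hne hs₁ hs₂ => ?_⟩
  · by_cases hp : p ∈ T
    · simpa [hp, hTS hp] using hφ.1 p
    · simp [hp]
  · have hmap : ∀ D ⊆ T, Multiset.map (fun q => if q ∈ T then φ q else 0) D.val =
        Multiset.map φ D.val := fun D hD =>
      Multiset.map_congr rfl fun q hq => if_pos (hD hq)
    rw [hmap _ hs₁, hmap _ hs₂]
    exact hφ.2 ℓ₁ h₁ ℓ₂ h₂ p hp hne (hs₁.trans hTS) (hs₂.trans hTS)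

/-- Extensions to `x` of valid colorings of `S`, with no condition at `x`. -/
def pointExtensions (Lines : Finset (Finset Pt)) (L : Pt → Finset ℕ) (S : Finset Pt) (x : Pt) :
    Finset (Pt → ℕ) :=
  (L x ×ˢ validColorings Lines L S).image fun a => Function.update a.2 x a.1

theorem card_pointExtensions {S : Finset Pt} {x : Pt} (hx : x ∉ S) :
    (pointExtensions Lines L S x).card = (L x).card * (validColorings Lines L S).card := by
  rw [pointExtensions, Finset.card_image_of_injOn, Finset.card_product]
  rintro ⟨a, φ⟩ h ⟨b, ψ⟩ h' heq
  simp only [Finset.coe_product, Set.mem_prod, Finset.mem_coe, mem_validColorings] at h h'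
  have hφ := h.2.1 x
  have hψ := h'.2.1 x
  simp only [hx, if_false, Finset.mem_singleton] at hφ hψ
  refine Prod.ext (by simpa using congrFun heq x) (funext fun q => ?_)
  by_cases hq : q = x
  · subst hq
    exact hφ.trans hψ.symm
  · simpa [hq] using congrFun heq q

/-- The extensions in which the lines `ℓ₁` and `ℓ₂` through `p` have become indistinguishable. -/
def badExtensions (Lines : Finset (Finset Pt)) (L : Pt → Finset ℕ) (S : Finset Pt) (x : Pt)
    (ℓ₁ : Finset Pt) (p : Pt) (ℓ₂ : Finset Pt) : Finset (Pt → ℕ) :=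
  (pointExtensions Lines L S x).filter fun φ => ℓ₁.erase p ⊆ insert x S ∧
    Multiset.map φ (ℓ₁.erase p).val = Multiset.map φ (ℓ₂.erase p).val ∧ ℓ₂.erase p ⊆ insert x S

theorem card_badExtensions_le {S : Finset Pt} {x p : Pt} {ℓ₁ ℓ₂ : Finset Pt}
    (hx₁ : x ∈ ℓ₁.erase p) (hdisj : Disjoint (ℓ₁.erase p) (ℓ₂.erase p)) :
    (badExtensions Lines L S x ℓ₁ p ℓ₂).card ≤
      (ℓ₁.erase p).card.factorial * (validColorings Lines L (S \ ℓ₁.erase p)).card := by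
  set D := ℓ₁.erase p with hD
  refine Finset.card_le_mul_card_image_of_maps_to
    (f := fun φ q => if q ∈ S \ D then φ q else 0) ?_ _ ?_
  · intro φ hφ
    obtain ⟨⟨a, ψ⟩, h, rfl⟩ := Finset.mem_image.1 (Finset.mem_filter.1 hφ).1
    convert restrict_mem_validColorings (Finset.sdiff_subset (s := S) (t := D))
      (Finset.mem_product.1 h).2 using 2 with q
    by_cases hq : q = x
    · subst hq
      simp [hx₁]
    · simp [hq]
  · intro χ _
    have off : ∀ φ ∈ (badExtensions Lines L S x ℓ₁ p ℓ₂).filter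
        (fun φ => (fun q => if q ∈ S \ D then φ q else 0) = χ), ∀ q ∉ D, φ q = χ q := by
      intro φ hφ q hq
      obtain ⟨hφB, rfl⟩ := Finset.mem_filter.1 hφ
      obtain ⟨⟨a, ψ⟩, h, rfl⟩ := Finset.mem_image.1 (Finset.mem_filter.1 hφB).1
      have hqx : q ≠ x := fun h => hq (h ▸ hx₁)
      by_cases hqS : q ∈ S
      · simp [hqS, hq]
      · have := (mem_validColorings.1 (Finset.mem_product.1 h).2).1 q
        simp only [hqS, if_false, Finset.mem_singleton] at this
        simp [hqS, hqx, this]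
    refine card_le_factorial_of_map_eq_s8 _ D χ (Multiset.map χ (ℓ₂.erase p).val) ?_ off
    intro φ hφ
    rw [(Finset.mem_filter.1 (Finset.mem_filter.1 hφ).1).2.2.1]
    exact Multiset.map_congr rfl fun q hq =>
      off φ hφ q fun hqD => Finset.disjoint_left.1 hdisj hqD hq

theorem pointExtensions_subset {S : Finset Pt} {x : Pt} :
    pointExtensions Lines L S x ⊆ validColorings Lines L (insert x S) ∪
      (Lines.filter (fun ℓ => x ∈ ℓ)).biUnion fun ℓ₁ => (ℓ₁.erase x).biUnion fun p =>
        ((Lines.filter (fun ℓ => p ∈ ℓ)).erase ℓ₁).biUnion fun ℓ₂ =>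
          badExtensions Lines L S x ℓ₁ p ℓ₂ := by
  intro φ hφ
  rw [Finset.mem_union, or_iff_not_imp_left]
  intro hnot
  obtain ⟨⟨a, ψ⟩, h, hψφ⟩ := Finset.mem_image.1 hφ
  obtain ⟨ha, hψ⟩ := Finset.mem_product.1 h
  rw [mem_validColorings] at hψ
  have hlist : ∀ p, φ p ∈ if p ∈ insert x S then L p else {0} := by
    intro q
    rw [← hψφ]
    by_cases hq : q = x
    · subst hq
      simpa using ha
    · simpa [hq] using hψ.1 q
  rw [mem_validColorings, not_and] at hnot
  have hbad := hnot hlist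
  push Not at hbad
  obtain ⟨ℓ₁, h₁, ℓ₂, h₂, p, hp, hne, hs₁, hs₂, heq⟩ := hbad
  rw [Finset.mem_inter] at hp
  simp only [Finset.mem_biUnion, Finset.mem_filter, Finset.mem_erase]
  by_cases hx₁ : x ∈ ℓ₁.erase p
  · rw [Finset.mem_erase] at hx₁
    exact ⟨ℓ₁, ⟨h₁, hx₁.2⟩, p, ⟨hx₁.1.symm, hp.1⟩, ℓ₂, ⟨hne.symm, h₂, hp.2⟩,
      Finset.mem_filter.2 ⟨hφ, hs₁, heq, hs₂⟩⟩
  by_cases hx₂ : x ∈ ℓ₂.erase p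
  · rw [Finset.mem_erase] at hx₂
    exact ⟨ℓ₂, ⟨h₂, hx₂.2⟩, p, ⟨hx₂.1.symm, hp.2⟩, ℓ₁, ⟨hne, h₁, hp.1⟩,
      Finset.mem_filter.2 ⟨hφ, hs₂, heq.symm, hs₁⟩⟩
  have hmap : ∀ D : Finset Pt, x ∉ D → Multiset.map φ D.val = Multiset.map ψ D.val := by
    intro D hD
    refine Multiset.map_congr rfl fun q hq => ?_
    have hqx : q ≠ x := fun h => hD (h ▸ hq)
    simp [← hψφ, hqx]
  rw [hmap _ hx₁, hmap _ hx₂] at heq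
  exact absurd heq (hψ.2 ℓ₁ h₁ ℓ₂ h₂ p (Finset.mem_inter.2 hp) hne
    ((Finset.subset_insert_iff_of_notMem hx₁).1 hs₁)
    ((Finset.subset_insert_iff_of_notMem hx₂).1 hs₂))

/-- If `β + r (r - 1) (k - 1) (k - 1)! / β ^ (k - 2)` is at most the size of every list, then each
additional point multiplies the number of valid colorings by at least `β`. -/
theorem mul_card_validColorings_le {k r : ℕ} {β : ℝ} (hβ : 0 < β)
    (hlinecard : ∀ ℓ ∈ Lines, ℓ.card = k)
    (hptdeg : ∀ p : Pt, (Lines.filter (fun ℓ => p ∈ ℓ)).card = r)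
    (hlines : ∀ ℓ₁ ∈ Lines, ∀ ℓ₂ ∈ Lines, ℓ₁ ≠ ℓ₂ → (ℓ₁ ∩ ℓ₂).card ≤ 1)
    (hL : ∀ p : Pt, β + (r * ((k - 1 : ℕ) * ((r - 1 : ℕ) * (k - 1).factorial)) : ℝ) / β ^ (k - 2)
      ≤ (L p).card) (S : Finset Pt) (x : Pt) (hx : x ∉ S) :
    β * (validColorings Lines L S).card ≤ (validColorings Lines L (insert x S)).card := by
  induction S using Finset.strongInduction generalizing x with
  | H S ih =>
  set c : ℝ := ((validColorings Lines L S).card : ℝ) with hc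
  set N : ℕ := ⌊((k - 1).factorial : ℝ) * c / β ^ (k - 2)⌋₊ with hN
  have hNle : (N : ℝ) ≤ ((k - 1).factorial : ℝ) * c / β ^ (k - 2) :=
    Nat.floor_le (by positivity)
  have hbad : ∀ ℓ₁ ∈ Lines.filter (fun ℓ => x ∈ ℓ), ∀ p ∈ ℓ₁.erase x,
      ∀ ℓ₂ ∈ (Lines.filter (fun ℓ => p ∈ ℓ)).erase ℓ₁,
        (badExtensions Lines L S x ℓ₁ p ℓ₂).card ≤ N := by
    intro ℓ₁ h₁ p hp ℓ₂ h₂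
    rw [Finset.mem_filter] at h₁
    rw [Finset.mem_erase] at hp
    rw [Finset.mem_erase, Finset.mem_filter] at h₂
    have hxD : x ∈ ℓ₁.erase p := Finset.mem_erase.2 ⟨hp.1.symm, h₁.2⟩
    have hDcard : (ℓ₁.erase p).card = k - 1 := by
      rw [Finset.card_erase_of_mem hp.2, hlinecard _ h₁.1]
    have hdisj : Disjoint (ℓ₁.erase p) (ℓ₂.erase p) := by
      rw [Finset.disjoint_left]
      intro q hq₁ hq₂
      rw [Finset.mem_erase] at hq₁ hq₂
      exact hq₁.1 (Finset.card_le_one.1 (hlines ℓ₁ h₁.1 ℓ₂ h₂.2.1 h₂.1.symm) q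
        (Finset.mem_inter.2 ⟨hq₁.2, hq₂.2⟩) p (Finset.mem_inter.2 ⟨hp.2, h₂.2.2⟩))
    by_cases hsub : ℓ₁.erase p ⊆ insert x S
    · refine Nat.le_floor ?_
      have hchain := pow_card_sdiff_mul_le hβ.le
        (fun U => ((validColorings Lines L U).card : ℝ))
        (Finset.sdiff_subset (s := S) (t := ℓ₁.erase p)) (fun U y hy hU =>
          ih U (Finset.ssubset_iff.2 ⟨y, hy, hU⟩) y hy)
      have hcard : (S \ (S \ ℓ₁.erase p)).card = k - 2 := by
        have : S \ (S \ ℓ₁.erase p) = (ℓ₁.erase p).erase x := by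
          ext q
          have hq := @hsub q
          have hqx : q ∈ S → q ≠ x := fun h h' => hx (h' ▸ h)
          simp only [Finset.mem_sdiff, Finset.mem_erase, Finset.mem_insert] at hq ⊢
          tauto
        rw [this, Finset.card_erase_of_mem hxD, hDcard]
        omega
      rw [hcard] at hchain
      have hle := card_badExtensions_le (Lines := Lines) (L := L) (S := S) hxD hdisj
      rw [hDcard] at hle
      rw [le_div_iff₀ (by positivity)]
      calc ((badExtensions Lines L S x ℓ₁ p ℓ₂).card : ℝ) * β ^ (k - 2)
          ≤ ((k - 1).factorial * (validColorings Lines L (S \ ℓ₁.erase p)).card : ℝ)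
              * β ^ (k - 2) := by
            gcongr
            exact_mod_cast hle
        _ = (k - 1).factorial *
              (β ^ (k - 2) * (validColorings Lines L (S \ ℓ₁.erase p)).card) := by ring
        _ ≤ _ := by gcongr
    · have : badExtensions Lines L S x ℓ₁ p ℓ₂ = ∅ :=
        Finset.filter_eq_empty_iff.2 fun φ _ h => hsub h.1
      simp [this]
  have hcount : (pointExtensions Lines L S x).card ≤
      (validColorings Lines L (insert x S)).card + r * ((k - 1) * ((r - 1) * N)) := by
    refine (Finset.card_le_card pointExtensions_subset).trans
      ((Finset.card_union_le _ _).trans (Nat.add_le_add_left ?_ _))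
    rw [← hptdeg x]
    refine Finset.card_biUnion_le_card_mul _ _ _ fun ℓ₁ h₁ => ?_
    have h₁' := Finset.mem_filter.1 h₁
    rw [← hlinecard ℓ₁ h₁'.1, ← Finset.card_erase_of_mem h₁'.2]
    refine Finset.card_biUnion_le_card_mul _ _ _ fun p hp => ?_
    have hmem : ℓ₁ ∈ Lines.filter (fun ℓ => p ∈ ℓ) :=
      Finset.mem_filter.2 ⟨h₁'.1, Finset.mem_of_mem_erase hp⟩
    rw [hptdeg x, ← hptdeg p, ← Finset.card_erase_of_mem hmem]
    exact Finset.card_biUnion_le_card_mul _ _ _ fun ℓ₂ h₂ => hbad ℓ₁ h₁ p hp ℓ₂ h₂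
  rw [card_pointExtensions hx] at hcount
  have hreal : ((L x).card : ℝ) * c ≤ (validColorings Lines L (insert x S)).card +
      r * ((k - 1 : ℕ) * ((r - 1 : ℕ) * (N : ℝ))) := by
    rw [hc]
    exact_mod_cast hcount
  have hmul := mul_le_mul_of_nonneg_right (hL x) (show 0 ≤ c by positivity)
  have hN' : (r * ((k - 1 : ℕ) * ((r - 1 : ℕ) * (N : ℝ))) : ℝ) ≤
      r * ((k - 1 : ℕ) * ((r - 1 : ℕ) * (((k - 1).factorial : ℝ) * c / β ^ (k - 2)))) := by
    gcongr
  have hrw : (r * ((k - 1 : ℕ) * ((r - 1 : ℕ) * (k - 1).factorial)) : ℝ) / β ^ (k - 2) * c =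
      r * ((k - 1 : ℕ) * ((r - 1 : ℕ) * (((k - 1).factorial : ℝ) * c / β ^ (k - 2)))) := by
    ring
  rw [add_mul, hrw] at hmul
  linarith

theorem validColorings_empty_nonempty (h : ∀ ℓ ∈ Lines, 1 < ℓ.card) :
    (validColorings Lines L ∅).Nonempty := by
  refine ⟨fun _ => 0, mem_validColorings.2 ⟨fun p => by simp, ?_⟩⟩
  intro ℓ₁ h₁ ℓ₂ _ p hp _ hs
  have hcard := Finset.card_erase_of_mem (Finset.mem_inter.1 hp).1
  rw [Finset.subset_empty.1 hs, Finset.card_empty] at hcard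
  have := h ℓ₁ h₁
  omega

end Colorings


/-- In a `(v,b,k,r)`-configuration with `k ≥ 3`, if every point has a list of at least
`R ≥ ⌈2 + (k-1)/(k-2) (r(r-1)(k-1)(k-2)·(k-1)!)^{1/(k-1)}⌉` colors, then one can choose a
color of each point from its list so that no two lines sharing a common point get the same
*multiset* of colors. -/
theorem configuration_list_coloring_multisets
    {Pt : Type} [Fintype Pt] [DecidableEq Pt]
    (v b k r R : ℕ) (hk : 3 ≤ k)
    (Lines : Finset (Finset Pt))
    (hv : Fintype.card Pt = v) (hb : Lines.card = b)
    (hlinecard : ∀ ℓ ∈ Lines, ℓ.card = k)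
    (hptdeg : ∀ p : Pt, (Lines.filter (fun ℓ => p ∈ ℓ)).card = r)
    (hlines : ∀ ℓ₁ ∈ Lines, ∀ ℓ₂ ∈ Lines, ℓ₁ ≠ ℓ₂ → (ℓ₁ ∩ ℓ₂).card ≤ 1)
    (hpts : ∀ p q : Pt, p ≠ q → (Lines.filter (fun ℓ => p ∈ ℓ ∧ q ∈ ℓ)).card ≤ 1)
    (L : Pt → Finset ℕ) (hL : ∀ p : Pt, R ≤ (L p).card)
    (hR : ⌈(2 : ℝ) + (((k : ℝ) - 1) / ((k : ℝ) - 2)) *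
        (((r : ℝ) * ((r : ℝ) - 1) * ((k : ℝ) - 1) * ((k : ℝ) - 2) *
            (Nat.factorial (k - 1) : ℝ)) ^ ((1 : ℝ) / ((k : ℝ) - 1)))⌉₊ ≤ R) :
    ∃ φ : Pt → ℕ, (∀ p : Pt, φ p ∈ L p) ∧
      ∀ ℓ₁ ∈ Lines, ∀ ℓ₂ ∈ Lines, ℓ₁ ≠ ℓ₂ → (ℓ₁ ∩ ℓ₂).Nonempty →
        Multiset.map φ ℓ₁.val ≠ Multiset.map φ ℓ₂.val := by
  have hk' : (3 : ℝ) ≤ k := by exact_mod_cast hk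
  have hkm : ((k - 1 : ℕ) : ℝ) = (k : ℝ) - 1 := by
    rw [Nat.cast_sub (by omega), Nat.cast_one]
  have hRL : ∀ p, (2 : ℝ) + (((k : ℝ) - 1) / ((k : ℝ) - 2)) *
        (((r : ℝ) * ((r : ℝ) - 1) * ((k : ℝ) - 1) * ((k : ℝ) - 2) *
            (Nat.factorial (k - 1) : ℝ)) ^ ((1 : ℝ) / ((k : ℝ) - 1))) ≤ (L p).card := fun p =>
    (Nat.ceil_le.1 hR).trans (by exact_mod_cast hL p)
  rcases Nat.lt_or_ge 1 r with hr | hr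
  · have hr' : (2 : ℝ) ≤ r := by exact_mod_cast hr
    have hrm : ((r - 1 : ℕ) : ℝ) = (r : ℝ) - 1 := by
      rw [Nat.cast_sub (by omega), Nat.cast_one]
    set A : ℝ := (r : ℝ) * ((r : ℝ) - 1) * ((k : ℝ) - 1) * ((k : ℝ) - 2) *
      (Nat.factorial (k - 1) : ℝ) with hA
    have hk1 : 0 < (k : ℝ) - 1 := by linarith
    have hk2 : 0 < (k : ℝ) - 2 := by linarith
    have hr1 : 0 < (r : ℝ) - 1 := by linarith
    have hApos : 0 < A := by positivity
    set β : ℝ := A ^ ((1 : ℝ) / ((k : ℝ) - 1)) with hβdef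
    have hβ : 0 < β := Real.rpow_pos_of_pos hApos _
    have hβpow : β * β ^ (k - 2) = A := by
      rw [← pow_succ', show k - 2 + 1 = k - 1 by omega, hβdef, ← hkm, one_div]
      exact Real.rpow_inv_natCast_pow hApos.le (by omega)
    have hquot : (r * ((k - 1 : ℕ) * ((r - 1 : ℕ) * (k - 1).factorial)) : ℝ) / β ^ (k - 2) =
        β / ((k : ℝ) - 2) := by
      rw [div_eq_div_iff (by positivity) hk2.ne', hβpow, hA, hkm, hrm]
      ring
    have hgrow := mul_card_validColorings_le (L := L) hβ hlinecard hptdeg hlines (fun p => by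
      rw [hquot]
      refine le_trans ?_ (hRL p)
      have : ((k : ℝ) - 1) / ((k : ℝ) - 2) * β = β + β / ((k : ℝ) - 2) := by
        field_simp
        ring
      rw [this]
      linarith)
    have hchain := pow_card_sdiff_mul_le hβ.le
      (fun U => ((validColorings Lines L U).card : ℝ)) (Finset.empty_subset Finset.univ)
      fun U x hx _ => hgrow U x hx
    have hempty : 0 < ((validColorings Lines L ∅).card : ℝ) := by
      exact_mod_cast (validColorings_empty_nonempty fun ℓ hℓ => by
        rw [hlinecard ℓ hℓ]; omega).card_pos
    have hpos : 0 < ((validColorings Lines L Finset.univ).card : ℝ) :=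
      lt_of_lt_of_le (by positivity) hchain
    obtain ⟨φ, hφ⟩ := Finset.card_pos.1 (Nat.cast_pos.1 hpos)
    rw [mem_validColorings] at hφ
    refine ⟨φ, fun p => by simpa using hφ.1 p, ?_⟩
    rintro ℓ₁ h₁ ℓ₂ h₂ hne ⟨p, hp⟩ heq
    refine hφ.2 ℓ₁ h₁ ℓ₂ h₂ p hp hne (Finset.subset_univ _) (Finset.subset_univ _) ?_
    rw [Finset.mem_inter] at hp
    have hcons : ∀ ℓ : Finset Pt, p ∈ ℓ →
        Multiset.map φ ℓ.val = φ p ::ₘ Multiset.map φ (ℓ.erase p).val := by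
      intro ℓ hℓ
      rw [Finset.erase_val, ← Multiset.map_cons, Multiset.cons_erase (Finset.mem_def.1 hℓ)]
    rw [hcons ℓ₁ hp.1, hcons ℓ₂ hp.2] at heq
    exact (Multiset.cons_inj_right _).1 heq
  · have hzero : (r : ℝ) * ((r : ℝ) - 1) = 0 := by
      interval_cases r <;> norm_num
    have hne : ∀ p, (L p).Nonempty := by
      intro p
      have h := hRL p
      have hexp : (1 : ℝ) / ((k : ℝ) - 1) ≠ 0 := one_div_ne_zero (by linarith)
      rw [hzero, zero_mul, zero_mul, zero_mul, Real.zero_rpow hexp, mul_zero, add_zero] at h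
      rw [← Finset.card_pos, ← Nat.cast_pos (α := ℝ)]
      linarith
    choose φ hφ using hne
    refine ⟨φ, hφ, ?_⟩
    rintro ℓ₁ h₁ ℓ₂ h₂ hne ⟨p, hp⟩
    rw [Finset.mem_inter] at hp
    exact absurd (Finset.card_le_one.1 ((hptdeg p).trans_le hr) ℓ₁
      (Finset.mem_filter.2 ⟨h₁, hp.1⟩) ℓ₂ (Finset.mem_filter.2 ⟨h₂, hp.2⟩)) hne
end

section
/- Let L be a family of straight lines in the plane in general position (no three lines share a common point), and fix a family P of points such that each line of L contains exactly k ≥ 3 points of P. Assume each point of P has a list of at least R colors. If R ≥ 1 + ⌊(k−1)/(k−2) · (4k²−8k)^{1/(k−1)}⌋, then for each point one can choose a color from its list so that no two lines that share a common point have the same sequence of colors (where the sequence of colors of a line is the colors of its k points read along the line, in either of the two directions). -/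
/-- The straight line through `a` with direction `d`, parametrized as `a + t • d`. -/
def linePts (a d : ℝ × ℝ) : Set (ℝ × ℝ) := {x | ∃ t : ℝ, x = a + t • d}

/-- The parameter of the point `x` with respect to the parametrization `t ↦ a + t • d`
(for `d ≠ 0` and `x` on the line, `a + lineParam a d x • d = x`). -/
noncomputable def lineParam (a d x : ℝ × ℝ) : ℝ :=
  ((x.1 - a.1) * d.1 + (x.2 - a.2) * d.2) / (d.1 ^ 2 + d.2 ^ 2)

open Classical in
/-- The sequence of colors (under the coloring `φ`) of the points of `P` lying on the line
`t ↦ a + t • d`, read along the line in the direction of increasing parameter. -/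
noncomputable def lineColorSeq (a d : ℝ × ℝ) (P : Finset (ℝ × ℝ)) (φ : ℝ × ℝ → ℕ) :
    List ℕ :=
  List.map (fun t => φ (a + t • d))
    (((P.filter (fun x => x ∈ linePts a d)).image (lineParam a d)).sort (· ≤ ·))

section Counting

variable {V E : Type*} [Fintype V] [DecidableEq V]

/-- The coloring `φ` restricted to `S`, extended by `0`. -/
def restrictColoring (S : Finset V) (φ : V → ℕ) : V → ℕ := fun v => if v ∈ S then φ v else 0

open Classical in
/-- The list colorings of `S` (extended by `0`) for which no event supported in `S` occurs. -/
noncomputable def goodColorings (L : V → Finset ℕ) (s : E → Finset V) (bad : E → (V → ℕ) → Prop)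
    (S : Finset V) : Finset (V → ℕ) :=
  (Fintype.piFinset (fun v => if v ∈ S then L v else {0})).filter
    (fun φ => ∀ e, s e ⊆ S → ¬ bad e φ)

theorem mem_goodColorings {L : V → Finset ℕ} {s : E → Finset V} {bad : E → (V → ℕ) → Prop}
    {S : Finset V} {φ : V → ℕ} :
    φ ∈ goodColorings L s bad S ↔
      (∀ v ∈ S, φ v ∈ L v) ∧ (∀ v ∉ S, φ v = 0) ∧ ∀ e, s e ⊆ S → ¬ bad e φ := by
  classical
  simp only [goodColorings, Finset.mem_filter, Fintype.mem_piFinset, ← and_assoc]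
  refine and_congr_left fun _ => ⟨fun h => ⟨fun v hv => ?_, fun v hv => ?_⟩, fun h v => ?_⟩
  · simpa [hv] using h v
  · simpa [hv] using h v
  · by_cases hv : v ∈ S
    · simpa [hv] using h.1 v hv
    · simpa [hv] using h.2 v hv

theorem restrictColoring_mem_goodColorings {L : V → Finset ℕ} {s : E → Finset V}
    {bad : E → (V → ℕ) → Prop}
    (hloc : ∀ e φ ψ, (∀ x ∈ s e, φ x = ψ x) → bad e φ → bad e ψ)
    {S T : Finset V} (hT : T ⊆ S) {φ : V → ℕ} (hφ : φ ∈ goodColorings L s bad S) :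
    restrictColoring T φ ∈ goodColorings L s bad T := by
  rw [mem_goodColorings] at hφ ⊢
  refine ⟨fun v hv => ?_, fun v hv => ?_, fun e he hb => ?_⟩
  · simpa [restrictColoring, hv] using hφ.1 v (hT hv)
  · simp [restrictColoring, hv]
  · exact hφ.2.2 e (he.trans hT)
      (hloc e _ _ (fun x hx => by simp [restrictColoring, he hx]) hb)

theorem pow_mul_card_goodColorings_le {L : V → Finset ℕ} {s : E → Finset V}
    {bad : E → (V → ℕ) → Prop} {β : ℝ} (hβ : 0 < β) {S : Finset V}
    (ih : ∀ (T : Finset V) (w : V), T.card < S.card → w ∉ T →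
      β * (goodColorings L s bad T).card ≤ (goodColorings L s bad (insert w T)).card)
    (G : Finset V) (hG : G ⊆ S) :
    β ^ G.card * (goodColorings L s bad (S \ G)).card ≤ (goodColorings L s bad S).card := by
  induction G using Finset.induction_on with
  | empty => simp
  | insert w G hw hi =>
    have hwS : w ∈ S := hG (Finset.mem_insert_self _ _)
    have h := ih (S \ insert w G) w
      (Finset.card_lt_card (Finset.ssubset_iff_subset_ne.2
        ⟨Finset.sdiff_subset, fun h => by rw [← h] at hwS; simp at hwS⟩)) (by simp)
    have heq : insert w (S \ insert w G) = S \ G := by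
      ext y
      by_cases hy : y = w
      · subst hy; simp [hwS, hw]
      · simp [hy]
    rw [heq] at h
    rw [Finset.card_insert_of_notMem hw, pow_succ, mul_assoc]
    exact (mul_le_mul_of_nonneg_left h (by positivity)).trans
      (hi ((Finset.subset_insert _ _).trans hG))

variable [Fintype E]

open Classical in
theorem mul_card_goodColorings_le_insert (L : V → Finset ℕ) (s : E → Finset V)
    (bad : E → (V → ℕ) → Prop)
    (hloc : ∀ e φ ψ, (∀ x ∈ s e, φ x = ψ x) → bad e φ → bad e ψ)
    (t N : ℕ)
    (hdet : ∀ e, ∀ v ∈ s e, ∃ F : Finset V, v ∈ F ∧ F ⊆ s e ∧ F.card = t + 1 ∧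
      ∀ φ ψ, bad e φ → bad e ψ → (∀ x ∉ F, φ x = ψ x) → φ = ψ)
    (hN : ∀ v, (Finset.univ.filter (fun e => v ∈ s e)).card ≤ N)
    {β : ℝ} (hβ : 0 < β) (hL : ∀ v, β + N / β ^ t ≤ (L v).card)
    (n : ℕ) : ∀ (S : Finset V) (v : V), S.card = n → v ∉ S →
    β * (goodColorings L s bad S).card ≤ (goodColorings L s bad (insert v S)).card := by
  induction n using Nat.strong_induction_on with
  | _ n ihn =>
  intro S v hSn hv
  have ih : ∀ (T : Finset V) (w : V), T.card < S.card → w ∉ T →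
      β * (goodColorings L s bad T).card ≤ (goodColorings L s bad (insert w T)).card :=
    fun T w hT hw => ihn T.card (hSn ▸ hT) T w rfl hw
  set C := goodColorings L s bad with hC
  let X : Finset (V → ℕ) := (C S ×ˢ L v).image (fun q => Function.update q.1 v q.2)
  have hXcard : X.card = (C S).card * (L v).card := by
    rw [Finset.card_image_of_injOn, Finset.card_product]
    rintro ⟨φ, c⟩ h1 ⟨ψ, c'⟩ h2 h
    simp only [Finset.coe_product, Set.mem_prod, Finset.mem_coe, hC, mem_goodColorings] at h1 h2
    have hc : c = c' := by simpa using congrFun h v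
    refine Prod.ext (funext fun y => ?_) hc
    by_cases hy : y = v
    · subst hy
      exact (h1.1.2.1 y hv).trans (h2.1.2.1 y hv).symm
    · simpa [hy] using congrFun h y
  let B : E → Finset (V → ℕ) := fun e => X.filter (fun φ => s e ⊆ insert v S ∧ bad e φ)
  have hsub : X ⊆ C (insert v S) ∪ (Finset.univ.filter (fun e => v ∈ s e)).biUnion B := by
    intro φ hφ
    by_cases hg : φ ∈ C (insert v S)
    · exact Finset.mem_union_left _ hg
    refine Finset.mem_union_right _ ?_
    have hφX := hφ
    obtain ⟨⟨ψ, c⟩, hq, rfl⟩ := Finset.mem_image.1 hφ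
    obtain ⟨hψ, hc⟩ := Finset.mem_product.1 hq
    rw [hC, mem_goodColorings] at hψ hg
    simp only at hg hc hψ
    obtain ⟨e, he, hb⟩ : ∃ e, s e ⊆ insert v S ∧ bad e (Function.update ψ v c) := by
      by_contra! hcon
      refine hg ⟨fun y hy => ?_, fun y hy => ?_, hcon⟩
      · by_cases hyv : y = v
        · subst hyv; simpa using hc
        · simpa [hyv] using hψ.1 y ((Finset.mem_insert.1 hy).resolve_left hyv)
      · rw [Finset.mem_insert, not_or] at hy
        simpa [hy.1] using hψ.2.1 y hy.2
    have hve : v ∈ s e := by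
      by_contra hve
      refine hψ.2.2 e (fun y hy => (Finset.mem_insert.1 (he hy)).resolve_left
        (fun h => hve (h ▸ hy))) (hloc e _ _ (fun y hy => ?_) hb)
      have : y ≠ v := fun h => hve (h ▸ hy)
      simp [this]
    simp only [Finset.mem_biUnion, Finset.mem_filter, Finset.mem_univ, true_and, B]
    exact ⟨e, hve, hφX, he, hb⟩
  have hB : ∀ e, v ∈ s e → ((B e).card : ℝ) ≤ (C S).card / β ^ t := by
    intro e hve
    by_cases he : s e ⊆ insert v S
    swap
    · have : B e = ∅ := by simp [B, he]
      rw [this]; simp only [Finset.card_empty, Nat.cast_zero]; positivity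
    obtain ⟨F, hvF, hFs, hFt, hF⟩ := hdet e v hve
    have hGS : F.erase v ⊆ S := fun y hy => by
      rw [Finset.mem_erase] at hy
      exact (Finset.mem_insert.1 (he (hFs hy.2))).resolve_left hy.1
    have hpow := pow_mul_card_goodColorings_le hβ ih (F.erase v) hGS
    rw [Finset.card_erase_of_mem hvF, hFt, Nat.add_sub_cancel] at hpow
    rw [le_div_iff₀' (by positivity)]
    refine (mul_le_mul_of_nonneg_left ?_ (by positivity)).trans hpow
    norm_cast
    refine Finset.card_le_card_of_injOn (restrictColoring (S \ F.erase v)) ?_ ?_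
    · intro φ hφ
      obtain ⟨hφX, -, -⟩ := Finset.mem_filter.1 hφ
      obtain ⟨⟨ψ, c⟩, hq, rfl⟩ := Finset.mem_image.1 hφX
      obtain ⟨hψ, hc⟩ := Finset.mem_product.1 hq
      have : restrictColoring (S \ F.erase v) (Function.update ψ v c) =
          restrictColoring (S \ F.erase v) ψ := by
        funext y
        unfold restrictColoring
        split_ifs with hy
        · have : y ≠ v := fun h => hv (h ▸ (Finset.mem_sdiff.1 hy).1)
          simp [this]
        · rfl
      change restrictColoring _ (Function.update ψ v c) ∈ _
      rw [this]
      exact restrictColoring_mem_goodColorings hloc Finset.sdiff_subset hψ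
    · have hzero : ∀ φ ∈ X, ∀ y ∉ insert v S, φ y = 0 := by
        intro φ hφX y hy
        obtain ⟨⟨ψ, c⟩, hq, rfl⟩ := Finset.mem_image.1 hφX
        obtain ⟨hψ, hc⟩ := Finset.mem_product.1 hq
        rw [Finset.mem_insert, not_or] at hy
        simpa [hy.1] using (mem_goodColorings.1 hψ).2.1 y hy.2
      intro φ hφ ψ hψ h
      obtain ⟨hφX, -, hφb⟩ := Finset.mem_filter.1 hφ
      obtain ⟨hψX, -, hψb⟩ := Finset.mem_filter.1 hψ
      refine hF φ ψ hφb hψb fun y hy => ?_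
      by_cases hyS : y ∈ insert v S
      · have hyv : y ≠ v := fun h => hy (h ▸ hvF)
        have := congrFun h y
        simpa [restrictColoring, hy, (Finset.mem_insert.1 hyS).resolve_left hyv] using this
      · rw [hzero φ hφX y hyS, hzero ψ hψX y hyS]
  have hsum : (((Finset.univ.filter (fun e => v ∈ s e)).biUnion B).card : ℝ) ≤
      N * ((C S).card / β ^ t) := by
    calc (((Finset.univ.filter (fun e => v ∈ s e)).biUnion B).card : ℝ)
        ≤ ((∑ e ∈ Finset.univ.filter (fun e => v ∈ s e), (B e).card : ℕ) : ℝ) := by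
          exact_mod_cast Finset.card_biUnion_le
      _ ≤ (Finset.univ.filter (fun e => v ∈ s e)).card • ((C S).card / β ^ t : ℝ) := by
          rw [Nat.cast_sum]
          exact Finset.sum_le_card_nsmul _ _ _ fun e he => hB e (Finset.mem_filter.1 he).2
      _ ≤ N * ((C S).card / β ^ t) := by
          rw [nsmul_eq_mul]
          exact mul_le_mul_of_nonneg_right (by exact_mod_cast hN v) (by positivity)
  have hle : (X.card : ℝ) ≤ (C (insert v S)).card +
      ((Finset.univ.filter (fun e => v ∈ s e)).biUnion B).card := by
    exact_mod_cast (Finset.card_le_card hsub).trans (Finset.card_union_le _ _)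
  rw [hXcard, Nat.cast_mul] at hle
  have h1 := mul_le_mul_of_nonneg_left (hL v) (Nat.cast_nonneg (α := ℝ) (C S).card)
  have h2 : (C S).card * (β + N / β ^ t) = β * (C S).card + N * ((C S).card / β ^ t) := by ring
  linarith

open Classical in
/-- If every event through a given vertex forces the colors of `t + 1` vertices including the given
one, every vertex lies in at most `N` events, and the lists have size at least `β + N / β ^ t`,
then some list coloring avoids all events. -/
theorem exists_listColoring_avoiding (L : V → Finset ℕ) (s : E → Finset V)
    (bad : E → (V → ℕ) → Prop) (hs : ∀ e, (s e).Nonempty)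
    (hloc : ∀ e φ ψ, (∀ x ∈ s e, φ x = ψ x) → bad e φ → bad e ψ)
    (t N : ℕ)
    (hdet : ∀ e, ∀ v ∈ s e, ∃ F : Finset V, v ∈ F ∧ F ⊆ s e ∧ F.card = t + 1 ∧
      ∀ φ ψ, bad e φ → bad e ψ → (∀ x ∉ F, φ x = ψ x) → φ = ψ)
    (hN : ∀ v, (Finset.univ.filter (fun e => v ∈ s e)).card ≤ N)
    {β : ℝ} (hβ : 0 < β) (hL : ∀ v, β + N / β ^ t ≤ (L v).card) :
    ∃ φ : V → ℕ, (∀ v, φ v ∈ L v) ∧ ∀ e, ¬ bad e φ := by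
  have h := pow_mul_card_goodColorings_le (S := Finset.univ) hβ
    (fun T w _ hw => mul_card_goodColorings_le_insert L s bad hloc t N hdet hN hβ hL _ T w rfl hw)
    Finset.univ subset_rfl
  have h0 : (fun _ => 0) ∈ goodColorings L s bad (Finset.univ \ Finset.univ) := by
    rw [mem_goodColorings]
    refine ⟨by simp, by simp, fun e he => ?_⟩
    simp only [sdiff_self, Finset.bot_eq_empty, Finset.subset_empty] at he
    exact absurd he (hs e).ne_empty
  have hpos : 0 < (goodColorings L s bad Finset.univ).card := by
    have : (0 : ℝ) < (goodColorings L s bad (Finset.univ \ Finset.univ)).card := by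
      exact_mod_cast Finset.card_pos.2 ⟨_, h0⟩
    exact_mod_cast (by positivity : (0 : ℝ) < _).trans_le h
  obtain ⟨φ, hφ⟩ := Finset.card_pos.1 hpos
  rw [mem_goodColorings] at hφ
  exact ⟨φ, fun v => hφ.1 v (Finset.mem_univ _), fun e => hφ.2.2 e (Finset.subset_univ _)⟩

end Counting

section Pairs

variable {V : Type*} [DecidableEq V] {t : ℕ}

/-- The vertices of two sequences at the positions where the sequences differ. -/
def pairSupport (f g : Fin (t + 2) → V) : Finset V :=
  (Finset.univ.filter (fun i => f i ≠ g i)).image f ∪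
    (Finset.univ.filter (fun i => f i ≠ g i)).image g

theorem mem_pairSupport {f g : Fin (t + 2) → V} {v : V} :
    v ∈ pairSupport f g ↔ ∃ i, f i ≠ g i ∧ (f i = v ∨ g i = v) := by
  simp only [pairSupport, Finset.mem_union, Finset.mem_image, Finset.mem_filter, Finset.mem_univ,
    true_and]
  grind

theorem pairSupport_comm (f g : Fin (t + 2) → V) : pairSupport f g = pairSupport g f := by
  ext v
  simp only [mem_pairSupport]
  grind

theorem exists_determined_of_erase {f g : Fin (t + 2) → V} (hf : Function.Injective f)
    (c : Fin (t + 2)) (hc : ∀ i ≠ c, ∀ j, j ≠ c → g i ≠ f j)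
    {i : Fin (t + 2)} (hi : i ≠ c) :
    ∃ F : Finset V, f i ∈ F ∧ F ⊆ pairSupport f g ∧ F.card = t + 1 ∧
      ∀ φ ψ : V → ℕ, (∀ i, φ (f i) = φ (g i)) → (∀ i, ψ (f i) = ψ (g i)) →
        (∀ x ∉ F, φ x = ψ x) → φ = ψ := by
  refine ⟨(Finset.univ.erase c).image f, Finset.mem_image_of_mem _ (by simp [hi]), ?_, ?_, ?_⟩
  · intro v hv
    obtain ⟨j, hj, rfl⟩ := Finset.mem_image.1 hv
    have hjc : j ≠ c := (Finset.mem_erase.1 hj).1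
    exact mem_pairSupport.2 ⟨j, (hc j hjc j hjc).symm, Or.inl rfl⟩
  · rw [Finset.card_image_of_injective _ hf, Finset.card_erase_of_mem (Finset.mem_univ _)]
    simp
  · intro φ ψ hφ hψ h
    funext x
    by_cases hx : x ∈ (Finset.univ.erase c).image f
    · obtain ⟨j, hj, rfl⟩ := Finset.mem_image.1 hx
      have hjc : j ≠ c := (Finset.mem_erase.1 hj).1
      rw [hφ, hψ]
      refine h _ fun hmem => ?_
      obtain ⟨j', hj', he⟩ := Finset.mem_image.1 hmem
      exact hc j hjc j' (Finset.mem_erase.1 hj').1 he.symm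
    · exact h x hx

/-- If two sequences have exactly one common vertex, then equality of their color sequences
forces the colors of `t + 1` vertices, which can be chosen to include any vertex of the support. -/
theorem exists_determined {f g : Fin (t + 2) → V} (hf : Function.Injective f)
    (hg : Function.Injective g) {i₀ j₀ : Fin (t + 2)} (h₀ : f i₀ = g j₀)
    (huniq : ∀ i j, f i = g j → i = i₀) {v : V} (hv : v ∈ pairSupport f g) :
    ∃ F : Finset V, v ∈ F ∧ F ⊆ pairSupport f g ∧ F.card = t + 1 ∧
      ∀ φ ψ : V → ℕ, (∀ i, φ (f i) = φ (g i)) → (∀ i, ψ (f i) = ψ (g i)) →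
        (∀ x ∉ F, φ x = ψ x) → φ = ψ := by
  have huniq' : ∀ i j, f i = g j → j = j₀ := fun i j h =>
    hg (by rw [← h, huniq i j h, h₀])
  have hleft : ∀ i, i ≠ i₀ → ∃ F : Finset V, f i ∈ F ∧ F ⊆ pairSupport f g ∧ F.card = t + 1 ∧
      ∀ φ ψ : V → ℕ, (∀ i, φ (f i) = φ (g i)) → (∀ i, ψ (f i) = ψ (g i)) →
        (∀ x ∉ F, φ x = ψ x) → φ = ψ := fun i hi =>
    exists_determined_of_erase hf i₀ (fun _ _ j hj h => hj (huniq _ _ h.symm)) hi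
  have hright : ∀ i, i ≠ j₀ → ∃ F : Finset V, g i ∈ F ∧ F ⊆ pairSupport f g ∧ F.card = t + 1 ∧
      ∀ φ ψ : V → ℕ, (∀ i, φ (f i) = φ (g i)) → (∀ i, ψ (f i) = ψ (g i)) →
        (∀ x ∉ F, φ x = ψ x) → φ = ψ := fun i hi => by
    obtain ⟨F, h1, h2, h3, h4⟩ :=
      exists_determined_of_erase (g := f) hg j₀ (fun _ _ j hj h => hj (huniq' _ _ h)) hi
    exact ⟨F, h1, pairSupport_comm f g ▸ h2, h3, fun φ ψ hφ hψ =>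
      h4 φ ψ (fun i => (hφ i).symm) (fun i => (hψ i).symm)⟩
  have hmid : i₀ ≠ j₀ → ∃ F : Finset V, f i₀ ∈ F ∧ F ⊆ pairSupport f g ∧ F.card = t + 1 ∧
      ∀ φ ψ : V → ℕ, (∀ i, φ (f i) = φ (g i)) → (∀ i, ψ (f i) = ψ (g i)) →
        (∀ x ∉ F, φ x = ψ x) → φ = ψ := fun hne =>
    exists_determined_of_erase hf j₀ (fun _ hi j _ h => hi (huniq' _ _ h.symm)) hne
  obtain ⟨i, hi, rfl | rfl⟩ := mem_pairSupport.1 hv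
  · by_cases h : i = i₀
    · subst h
      exact hmid fun h => hi (by rw [h₀, h])
    · exact hleft i h
  · by_cases h : i = j₀
    · subst h
      rw [← h₀]
      exact hmid fun h => hi (by rw [← h₀, h])
    · exact hright i h

end Pairs

section Incidence

variable {V ι : Type*} [Fintype ι] [LinearOrder ι] {t : ℕ}

/-- The identity or the reversal of `Fin n`. -/
def orient {n : ℕ} (b : Bool) : Fin n → Fin n := if b then Fin.rev else id

theorem orient_involutive {n : ℕ} (b : Bool) : Function.Involutive (orient (n := n) b) := by
  cases b <;> intro i <;> simp [orient]

/-- Pairs of distinct lines with a common vertex, together with an orientation. -/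
abbrev MeetingPair (x : ι → Fin (t + 2) → V) : Type _ :=
  {q : ι × ι × Bool // q.1 < q.2.1 ∧ ∃ i j, x q.1 i = x q.2.1 j}

open Classical in
theorem card_meetingPair_le (x : ι → Fin (t + 2) → V)
    (hgen : ∀ l₁ l₂ l₃ : ι, l₁ ≠ l₂ → l₁ ≠ l₃ → l₂ ≠ l₃ → ∀ i j m,
      ¬ (x l₁ i = x l₂ j ∧ x l₁ i = x l₃ m)) (v : V) :
    (Finset.univ.filter (fun e : MeetingPair x => (∃ i, x e.1.1 i = v) ∨ ∃ i, x e.1.2.1 i = v)).card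
      ≤ 4 * (t + 2) := by
  let T : Finset ι := Finset.univ.filter (fun l => ∃ i, x l i = v)
  have hT : T.card ≤ 2 := by
    by_contra! h
    obtain ⟨l₁, h1, l₂, h2, l₃, h3, h12, h13, h23⟩ := Finset.two_lt_card.1 h
    simp only [T, Finset.mem_filter, Finset.mem_univ, true_and] at h1 h2 h3
    obtain ⟨i, hi⟩ := h1
    obtain ⟨j, hj⟩ := h2
    obtain ⟨m, hm⟩ := h3
    exact hgen l₁ l₂ l₃ h12 h13 h23 i j m ⟨by rw [hi, hj], by rw [hi, hm]⟩
  have key : ∀ e : MeetingPair x, ((∃ i, x e.1.1 i = v) ∨ ∃ i, x e.1.2.1 i = v) →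
      ∃ q : ι × Fin (t + 2) × Bool, q.1 ∈ T ∧ q.2.2 = e.1.2.2 ∧
        ∃ o, o ≠ q.1 ∧ (∃ j, x q.1 q.2.1 = x o j) ∧
          (e.1.1 = q.1 ∧ e.1.2.1 = o ∨ e.1.1 = o ∧ e.1.2.1 = q.1) := by
    rintro ⟨⟨l, m, b⟩, hlt, i, j, hij⟩ h
    simp only at h hlt hij
    rcases h with h | h
    · exact ⟨(l, i, b), by simpa [T] using h, rfl, m, hlt.ne', ⟨j, hij⟩, Or.inl ⟨rfl, rfl⟩⟩
    · exact ⟨(m, j, b), by simpa [T] using h, rfl, l, hlt.ne, ⟨i, hij.symm⟩, Or.inr ⟨rfl, rfl⟩⟩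
  rcases isEmpty_or_nonempty ι with hι | hι
  · rw [Finset.card_eq_zero.2 (Finset.filter_eq_empty_iff.2 fun e => hι.elim e.1.1)]
    exact Nat.zero_le _
  choose! F hFT hFb hFo using key
  have hinj : Set.InjOn F ((Finset.univ.filter (fun e : MeetingPair x =>
      (∃ i, x e.1.1 i = v) ∨ ∃ i, x e.1.2.1 i = v) : Finset (MeetingPair x)) :
        Set (MeetingPair x)) := by
    intro e he e' he' h
    have he := (Finset.mem_filter.1 he).2
    have he' := (Finset.mem_filter.1 he').2
    have hb := hFb e he
    have hb' := hFb e' he'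
    obtain ⟨o, ho, ⟨j, hj⟩, hc⟩ := hFo e he
    obtain ⟨o', ho', ⟨j', hj'⟩, hc'⟩ := hFo e' he'
    rw [← h] at hb' ho' hj' hc'
    have hoo : o = o' := by
      by_contra hne
      exact hgen _ o o' ho.symm ho'.symm hne _ j j' ⟨hj, hj'⟩
    subst hoo
    have hlt := e.2.1
    have hlt' := e'.2.1
    apply Subtype.ext
    refine Prod.ext ?_ (Prod.ext ?_ (hb.symm.trans hb'))
    all_goals
      rcases hc with ⟨h1, h2⟩ | ⟨h1, h2⟩ <;> rcases hc' with ⟨h3, h4⟩ | ⟨h3, h4⟩ <;>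
        rw [h1, h2] at hlt <;> rw [h3, h4] at hlt' <;>
        first
        | exact absurd hlt' hlt.asymm
        | rw [h1, h3]
        | rw [h2, h4]
  calc _ ≤ (T ×ˢ (Finset.univ : Finset (Fin (t + 2) × Bool))).card := by
        refine Finset.card_le_card_of_injOn F (fun e he => ?_) hinj
        simpa using hFT e (Finset.mem_filter.1 he).2
    _ ≤ 4 * (t + 2) := by
        rw [Finset.card_product, Finset.card_univ, Fintype.card_prod, Fintype.card_fin,
          Fintype.card_bool]
        nlinarith

theorem exists_listColoring_distinguishing [Fintype V] (x : ι → Fin (t + 2) → V)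
    (hx : ∀ l, Function.Injective (x l))
    (hpair : ∀ l m : ι, l ≠ m → ∀ i j i' j', x l i = x m j → x l i' = x m j' → i = i')
    (hgen : ∀ l₁ l₂ l₃ : ι, l₁ ≠ l₂ → l₁ ≠ l₃ → l₂ ≠ l₃ → ∀ i j m,
      ¬ (x l₁ i = x l₂ j ∧ x l₁ i = x l₃ m))
    (L : V → Finset ℕ) {β : ℝ} (hβ : 0 < β)
    (hL : ∀ v, β + (4 * (t + 2) : ℕ) / β ^ t ≤ (L v).card) :
    ∃ φ : V → ℕ, (∀ v, φ v ∈ L v) ∧ ∀ l m, l < m → (∃ i j, x l i = x m j) → ∀ b,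
      ¬ ∀ i, φ (x l i) = φ (x m (orient b i)) := by
  classical
  let s : MeetingPair x → Finset V := fun e => pairSupport (x e.1.1) (x e.1.2.1 ∘ orient e.1.2.2)
  let bad : MeetingPair x → (V → ℕ) → Prop :=
    fun e φ => ∀ i, φ (x e.1.1 i) = φ ((x e.1.2.1 ∘ orient e.1.2.2) i)
  suffices h : ∃ φ : V → ℕ, (∀ v, φ v ∈ L v) ∧ ∀ e, ¬ bad e φ by
    obtain ⟨φ, hφL, hφ⟩ := h
    exact ⟨φ, hφL, fun l m hlm hmeet b hb => hφ ⟨(l, m, b), hlm, hmeet⟩ hb⟩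
  refine exists_listColoring_avoiding L s bad ?_ ?_ t (4 * (t + 2)) ?_ ?_ hβ hL
  · rintro ⟨⟨l, m, b⟩, hlt, i, j, hij⟩
    simp only at hlt hij
    obtain ⟨i', hi'⟩ := exists_ne i
    refine ⟨x l i', mem_pairSupport.2 ⟨i', fun h => hi' ?_, Or.inl rfl⟩⟩
    exact hpair l m hlt.ne _ _ _ _ h hij
  · intro e φ ψ h hb i
    by_cases hi : x e.1.1 i = (x e.1.2.1 ∘ orient e.1.2.2) i
    · rw [hi]
    · rw [← h _ (mem_pairSupport.2 ⟨i, hi, Or.inl rfl⟩),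
        ← h _ (mem_pairSupport.2 ⟨i, hi, Or.inr rfl⟩)]
      exact hb i
  · rintro ⟨⟨l, m, b⟩, hlt, i, j, hij⟩ v hv
    simp only at hlt hij
    exact exists_determined (hx l) ((hx m).comp (orient_involutive b).injective)
      (i₀ := i) (j₀ := orient b j) (by simpa [orient_involutive b j] using hij)
      (fun i' j' h => hpair l m hlt.ne _ _ _ _ h hij) hv
  · intro v
    refine (Finset.card_le_card fun e he => ?_).trans (card_meetingPair_le x hgen v)
    simp only [Finset.mem_filter, Finset.mem_univ, true_and] at he ⊢
    obtain ⟨i, -, h | h⟩ := mem_pairSupport.1 he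
    · exact Or.inl ⟨i, h⟩
    · exact Or.inr ⟨_, h⟩

end Incidence

section Geometry

theorem lineParam_add_smul {d : ℝ × ℝ} (hd : d ≠ 0) (a : ℝ × ℝ) (t : ℝ) :
    lineParam a d (a + t • d) = t := by
  have h : d.1 ^ 2 + d.2 ^ 2 ≠ 0 := by
    intro h
    apply hd
    have h1 : d.1 = 0 := by nlinarith [sq_nonneg d.1, sq_nonneg d.2]
    have h2 : d.2 = 0 := by nlinarith [sq_nonneg d.1, sq_nonneg d.2]
    exact Prod.ext h1 h2
  simp only [lineParam, Prod.fst_add, Prod.snd_add, Prod.smul_fst, Prod.smul_snd, smul_eq_mul]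
  rw [div_eq_iff h]
  ring

theorem linePts_eq_of_mem {a d p q : ℝ × ℝ} (hp : p ∈ linePts a d) (hq : q ∈ linePts a d)
    (hpq : p ≠ q) : linePts a d = linePts p (q - p) := by
  obtain ⟨r, rfl⟩ := hp
  obtain ⟨u, rfl⟩ := hq
  have hru : u - r ≠ 0 := fun h => hpq (by rw [sub_eq_zero.1 h])
  ext y
  constructor
  · rintro ⟨w, rfl⟩
    refine ⟨(w - r) / (u - r), ?_⟩
    ext <;> simp <;> field_simp <;> ring
  · rintro ⟨w, rfl⟩
    refine ⟨r + w * (u - r), ?_⟩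
    ext <;> simp <;> ring

open Classical in
/-- The points of `P` on a line, enumerated along the line, give its color sequence. -/
theorem exists_line_enumeration {k : ℕ} {a d : ℝ × ℝ} (hd : d ≠ 0) {P : Finset (ℝ × ℝ)}
    (hP : (P.filter (fun x => x ∈ linePts a d)).card = k) :
    ∃ x : Fin k → {p // p ∈ P}, Function.Injective x ∧ (∀ i, (x i : ℝ × ℝ) ∈ linePts a d) ∧
      (∀ p ∈ P, p ∈ linePts a d → ∃ i, (x i : ℝ × ℝ) = p) ∧
      ∀ φ : ℝ × ℝ → ℕ, lineColorSeq a d P φ = List.ofFn (fun i => φ (x i)) := by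
  set T := (P.filter (fun x => x ∈ linePts a d)).image (lineParam a d) with hT
  have hparam : ∀ p ∈ linePts a d, a + lineParam a d p • d = p := by
    rintro p ⟨r, rfl⟩
    rw [lineParam_add_smul hd]
  have hcard : T.card = k := by
    rw [hT, Finset.card_image_of_injOn, hP]
    intro p hp q hq h
    rw [← hparam p (Finset.mem_filter.1 hp).2, h, hparam q (Finset.mem_filter.1 hq).2]
  have hmem : ∀ r ∈ T, a + r • d ∈ P := by
    intro r hr
    obtain ⟨p, hp, rfl⟩ := Finset.mem_image.1 hr
    rw [hparam p (Finset.mem_filter.1 hp).2]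
    exact (Finset.mem_filter.1 hp).1
  refine ⟨fun i => ⟨a + T.orderEmbOfFin hcard i • d, hmem _ (T.orderEmbOfFin_mem hcard i)⟩,
    fun i j h => ?_, fun i => ⟨_, rfl⟩, fun p hp hpl => ?_, fun φ => ?_⟩
  · have h := congrArg (lineParam a d) (congrArg Subtype.val h)
    simp only [lineParam_add_smul hd] at h
    exact (T.orderEmbOfFin hcard).injective h
  · have : lineParam a d p ∈ Set.range (T.orderEmbOfFin hcard) := by
      rw [Finset.range_orderEmbOfFin]
      exact Finset.mem_image_of_mem _ (Finset.mem_filter.2 ⟨hp, hpl⟩)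
    obtain ⟨i, hi⟩ := this
    exact ⟨i, by simp only [hi, hparam p hpl]⟩
  · unfold lineColorSeq
    rw [← hT]
    apply List.ext_getElem
    · simp [hcard]
    · intro i h1 h2
      simp [Finset.orderEmbOfFin_apply]

end Geometry

theorem ofFn_comp_rev {α : Type*} {n : ℕ} (f : Fin n → α) :
    List.ofFn (fun i => f i.rev) = (List.ofFn f).reverse := by
  apply List.ext_getElem
  · simp
  · intro i h1 h2
    simp only [List.getElem_ofFn, List.getElem_reverse, List.length_ofFn]
    congr 1
    ext
    simp only [Fin.val_rev]
    omega

theorem add_div_pow_eq {t : ℕ} (ht : 1 ≤ t) {k : ℝ} (hk : k = t + 2) :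
    let β : ℝ := (4 * k ^ 2 - 8 * k) ^ ((1 : ℝ) / (k - 1))
    0 < β ∧ β + (4 * (t + 2) : ℕ) / β ^ t = (k - 1) / (k - 2) * β := by
  intro β
  have ht' : (1 : ℝ) ≤ t := by exact_mod_cast ht
  have hpos : 0 < 4 * k ^ 2 - 8 * k := by rw [hk]; nlinarith
  have hβ : 0 < β := Real.rpow_pos_of_pos hpos _
  refine ⟨hβ, ?_⟩
  have hpow : β ^ t * β = 4 * (t + 2) * t := by
    rw [← pow_succ, ← Real.rpow_natCast, ← Real.rpow_mul hpos.le]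
    have : (1 : ℝ) / (k - 1) * ((t + 1 : ℕ) : ℝ) = 1 := by
      have : (t : ℝ) + 2 - 1 = t + 1 := by ring
      rw [hk, this]; push_cast; field_simp
    rw [this, Real.rpow_one, hk]
    ring
  have hdiv : ((4 * (t + 2) : ℕ) : ℝ) / β ^ t = β / t := by
    rw [div_eq_div_iff (by positivity) (by positivity)]
    push_cast
    linarith
  rw [hdiv, hk]
  have h1 : (t : ℝ) + 2 - 2 = t := by ring
  rw [h1]
  field_simp
  ring

open Classical in
/-- Let `L` be a family of straight lines in the plane in general position (no three lines
share a common point), given by base points `a l` and nonzero directions `d l`, and let `P`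
be a set of points such that each line contains exactly `k ≥ 3` of them.  If every point
has a list of at least `R ≥ 1 + ⌊(k-1)/(k-2)(4k²-8k)^{1/(k-1)}⌋` colors, then one can pick
a color of each point from its list so that no two lines sharing a common point have the
same sequence of colors, read along the lines in either direction. -/
theorem lines_distinguished_by_sequences
    {ι : Type} [Fintype ι] (k R : ℕ) (hk : 3 ≤ k)
    (a d : ι → ℝ × ℝ) (hd : ∀ l : ι, d l ≠ 0)
    (hinj : ∀ l l' : ι, linePts (a l) (d l) = linePts (a l') (d l') → l = l')
    (hgen : ∀ l₁ l₂ l₃ : ι, l₁ ≠ l₂ → l₁ ≠ l₃ → l₂ ≠ l₃ →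
      ¬ ∃ x : ℝ × ℝ, x ∈ linePts (a l₁) (d l₁) ∧ x ∈ linePts (a l₂) (d l₂) ∧
        x ∈ linePts (a l₃) (d l₃))
    (P : Finset (ℝ × ℝ))
    (hP : ∀ l : ι, (P.filter (fun x => x ∈ linePts (a l) (d l))).card = k)
    (L : ℝ × ℝ → Finset ℕ) (hL : ∀ p ∈ P, R ≤ (L p).card)
    (hR : 1 + ⌊(((k : ℝ) - 1) / ((k : ℝ) - 2)) *
        ((4 * (k : ℝ) ^ 2 - 8 * (k : ℝ)) ^ ((1 : ℝ) / ((k : ℝ) - 1)))⌋₊ ≤ R) :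
    ∃ φ : ℝ × ℝ → ℕ, (∀ p ∈ P, φ p ∈ L p) ∧
      ∀ l₁ l₂ : ι, l₁ ≠ l₂ →
        (∃ p ∈ P, p ∈ linePts (a l₁) (d l₁) ∧ p ∈ linePts (a l₂) (d l₂)) →
        lineColorSeq (a l₁) (d l₁) P φ ≠ lineColorSeq (a l₂) (d l₂) P φ ∧
        lineColorSeq (a l₁) (d l₁) P φ ≠ (lineColorSeq (a l₂) (d l₂) P φ).reverse := by
  obtain ⟨t, rfl⟩ : ∃ t, k = t + 2 := ⟨k - 2, by omega⟩
  choose x hx hxl hxs hseq using fun l => exists_line_enumeration (hd l) (hP l)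
  let _ : LinearOrder ι := LinearOrder.lift' (Fintype.equivFin ι) (Fintype.equivFin ι).injective
  obtain ⟨hβ, hβeq⟩ := add_div_pow_eq (t := t) (by omega)
    (k := ((t + 2 : ℕ) : ℝ)) (by push_cast; ring)
  obtain ⟨φ, hφL, hφ⟩ : ∃ φ : {p // p ∈ P} → ℕ, (∀ v, φ v ∈ L v.1) ∧
      ∀ l m, l < m → (∃ i j, x l i = x m j) → ∀ b,
        ¬ ∀ i, φ (x l i) = φ (x m (orient b i)) := by
    refine exists_listColoring_distinguishing x hx ?_ ?_ (fun v => L v.1) hβ (fun v => ?_)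
    · intro l m hlm i j i' j' h h'
      by_contra hne
      have hpq : (x l i : ℝ × ℝ) ≠ x l i' := fun he => hne (hx l (Subtype.ext he))
      refine hlm (hinj l m ?_)
      have hmi : (x l i : ℝ × ℝ) ∈ linePts (a m) (d m) := h ▸ hxl m j
      have hmi' : (x l i' : ℝ × ℝ) ∈ linePts (a m) (d m) := h' ▸ hxl m j'
      exact (linePts_eq_of_mem (hxl l i) (hxl l i') hpq).trans
        (linePts_eq_of_mem hmi hmi' hpq).symm
    · rintro l₁ l₂ l₃ h12 h13 h23 i j m ⟨h, h'⟩
      exact hgen l₁ l₂ l₃ h12 h13 h23 ⟨x l₁ i, hxl l₁ i, h ▸ hxl l₂ j, h' ▸ hxl l₃ m⟩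
    · rw [hβeq]
      have hRv := hR.trans (hL v.1 v.2)
      rw [add_comm, Nat.add_one_le_iff] at hRv
      exact (Nat.lt_of_floor_lt hRv).le
  have hext : ∀ v : {p // p ∈ P}, (fun p => if h : p ∈ P then φ ⟨p, h⟩ else 0) v.1 = φ v :=
    fun v => by simp
  refine ⟨fun p => if h : p ∈ P then φ ⟨p, h⟩ else 0, fun p hp => ?_, ?_⟩
  · simpa [hp] using hφL ⟨p, hp⟩
  have main : ∀ l m : ι, l < m →
      (∃ p ∈ P, p ∈ linePts (a l) (d l) ∧ p ∈ linePts (a m) (d m)) →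
      List.ofFn (fun i => φ (x l i)) ≠ List.ofFn (fun i => φ (x m i)) ∧
      List.ofFn (fun i => φ (x l i)) ≠ (List.ofFn (fun i => φ (x m i))).reverse := by
    rintro l m hlm ⟨p, hp, hpl, hpm⟩
    obtain ⟨i, hi⟩ := hxs l p hp hpl
    obtain ⟨j, hj⟩ := hxs m p hp hpm
    have h := hφ l m hlm ⟨i, j, Subtype.ext (hi.trans hj.symm)⟩
    refine ⟨fun he => h false fun i => ?_, fun he => h true fun i => ?_⟩
    · exact congrFun (List.ofFn_injective he) i
    · rw [← ofFn_comp_rev] at he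
      exact congrFun (List.ofFn_injective he) i
  intro l m hlm hmeet
  simp only [hseq, hext]
  rcases lt_or_gt_of_ne hlm with h | h
  · exact main l m h hmeet
  · obtain ⟨p, hp, hpl, hpm⟩ := hmeet
    obtain ⟨h1, h2⟩ := main m l h ⟨p, hp, hpm, hpl⟩
    exact ⟨h1.symm, fun he => h2 (by rw [he, List.reverse_reverse])⟩
end

section
/- Let G be a bipartite graph with bipartition classes A and B such that every vertex b ∈ B has degree exactly k. If |B| ≤ 0.1 · √(k/ln k) · 2^k, then G admits an edge labeling with two labels distinguishing neighbors by sets, i.e., gndi(G) = 2 (when G has at least one edge). Moreover, if k is sufficiently large, the hypothesis can be weakened to |B| ≤ 0.7 · √(k/ln k) · 2^k. -/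
section

open Finset

/-- A hypergraph with a vertex weighting admitting no ordered 2-chain has property B. -/
theorem exists_bicoloring_of_no_ordered_chain {V ι : Type*} [Fintype V] [DecidableEq V]
    (H : ι → Finset V) (hne : ∀ i, (H i).Nonempty) (w : V → ℕ)
    (h : ∀ i j v, H i ∩ H j = {v} → (∀ u ∈ H i, w u ≤ w v) → ¬ ∀ u ∈ H j, w v ≤ w u) :
    ∃ s : Set V, ∀ i, (∃ u ∈ H i, u ∈ s) ∧ ∃ u ∈ H i, u ∉ s := by
  classical
  -- break ties in `w` to obtain an injective key
  obtain ⟨κ, hκ, hκw⟩ : ∃ κ : V → ℕ, Function.Injective κ ∧ ∀ u v, κ u ≤ κ v → w u ≤ w v := by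
    let e := Fintype.equivFin V
    refine ⟨fun v => w v * Fintype.card V + e v, fun u v huv => ?_, fun u v huv => ?_⟩
    · have h1 := congrArg (· % Fintype.card V) huv
      simp only [Nat.mul_add_mod_of_lt (e u).isLt, Nat.mul_add_mod_of_lt (e v).isLt] at h1
      exact e.injective (Fin.ext h1)
    · by_contra! hlt
      have h1 := (e v).isLt
      have h2 : (w v + 1) * Fintype.card V ≤ w u * Fintype.card V := Nat.mul_le_mul_right _ hlt
      simp only at huv
      rw [Nat.add_mul] at h2
      omega
  -- the greedy set: `v` is taken exactly when some edge through it would otherwise be missed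
  obtain ⟨s, hs⟩ : ∃ s : V → Prop, ∀ v, s v ↔
      ∃ i, v ∈ H i ∧ ∀ u ∈ H i, u ≠ v → κ u < κ v ∧ ¬ s u := by
    let F : (v : V) → ((u : V) → κ u < κ v → Prop) → Prop := fun v rec =>
      ∃ i, v ∈ H i ∧ ∀ u ∈ H i, u ≠ v → ∃ hlt : κ u < κ v, ¬ rec u hlt
    have wf : WellFounded (fun u v : V => κ u < κ v) := (measure κ).wf
    refine ⟨wf.fix F, fun v => ?_⟩
    rw [wf.fix_eq]
    simp only [F, exists_prop]
  refine ⟨{v | s v}, fun i => ⟨?_, ?_⟩⟩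
  · by_contra! hcon
    obtain ⟨v, hv, hmax⟩ := exists_max_image (H i) κ (hne i)
    exact hcon v hv ((hs v).2 ⟨i, hv, fun u hu huv =>
      ⟨lt_of_le_of_ne (hmax u hu) fun he => huv (hκ he), hcon u hu⟩⟩)
  · by_contra! hcon
    obtain ⟨v, hv, hmin⟩ := exists_min_image (H i) κ (hne i)
    obtain ⟨j, hvj, hj⟩ := (hs v).1 (hcon v hv)
    refine h j i v ?_ (fun u hu => ?_) fun u hu => hκw _ _ (hmin u hu)
    · ext u
      simp only [mem_inter, mem_singleton]
      refine ⟨fun ⟨hu, hu'⟩ => ?_, fun hu => hu ▸ ⟨hvj, hv⟩⟩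
      by_contra huv
      exact (hj u hu huv).2 (hcon u hu')
    · by_cases huv : u = v
      · rw [huv]
      · exact hκw _ _ (hj u hu huv).1.le

/-- The proportion of functions `V → Fin N` lying in a box. -/
theorem card_piFinset_div {V : Type*} [Fintype V] [DecidableEq V] {N : ℕ}
    (S : V → Finset (Fin N)) :
    (#(Fintype.piFinset S) : ℝ) / (N : ℝ) ^ Fintype.card V = ∏ u, ((#(S u) : ℝ) / N) := by
  rw [Fintype.card_piFinset, Nat.cast_prod, prod_div_distrib, prod_const, card_univ]

/-- The proportion of functions mapping `e` into `T`. -/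
theorem card_piFinset_ite_div {V : Type*} [Fintype V] [DecidableEq V] {N : ℕ} (hN : 0 < N)
    (e : Finset V) (T : Finset (Fin N)) :
    (#(Fintype.piFinset fun u => if u ∈ e then T else univ) : ℝ) / (N : ℝ) ^ Fintype.card V
      = ((#T : ℝ) / N) ^ #e := by
  have hN0 : (N : ℝ) ≠ 0 := by positivity
  rw [card_piFinset_div, ← prod_const, ← prod_subset (subset_univ e)]
  · exact prod_congr rfl fun u hu => by rw [if_pos hu]
  · intro u _ hu
    rw [if_neg hu, card_univ, Fintype.card_fin, div_self hN0]

/-- The proportion of functions taking the value `x` at `v`, the common vertex of `e` and `f`,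
at most `x` on `e` and at least `x` on `f`. -/
theorem card_piFinset_chain_div_le {V : Type*} [Fintype V] [DecidableEq V] {N k : ℕ} (hN : 0 < N)
    {e f : Finset V} (he : #e = k) (hf : #f = k) {v : V} (hv : e ∩ f = {v}) (x : Fin N) :
    (#(Fintype.piFinset fun u => if u = v then {x} else
        if u ∈ e then Iic x else if u ∈ f then Ici x else univ) : ℝ) / (N : ℝ) ^ Fintype.card V
      ≤ 1 / N * ((1 + 1 / (N : ℝ)) ^ 2 / 4) ^ (k - 1) := by
  have hN0 : (0 : ℝ) < N := by positivity
  have hvef : v ∈ e ∩ f := by simp [hv]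
  rw [mem_inter] at hvef
  have hdisj : ∀ u, u ∈ e → u ∈ f → u = v := fun u h1 h2 => by
    simpa [hv] using mem_inter.2 ⟨h1, h2⟩
  set a : ℝ := ((x : ℕ) + 1) / N
  set b : ℝ := (N - (x : ℕ)) / N
  have key : ∀ u, ((#(if u = v then {x} else
        if u ∈ e then Iic x else if u ∈ f then Ici x else univ) : ℝ) / N)
      = (if u ∈ ({v} : Finset V) then 1 / (N : ℝ) else 1) * (if u ∈ e.erase v then a else 1) *
        (if u ∈ f.erase v then b else 1) := by
    intro u
    have hd := hdisj u
    by_cases huv : u = v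
    · simp [huv]
    · by_cases hue : u ∈ e
      · have : u ∉ f := fun h => huv (hd hue h)
        simp [huv, hue, this, a]
      · by_cases huf : u ∈ f
        · simp [huv, hue, huf, b, Nat.cast_sub x.isLt.le]
        · simp [huv, hue, huf, hN0.ne']
  rw [card_piFinset_div, prod_congr rfl fun u _ => key u, prod_mul_distrib, prod_mul_distrib]
  simp only [prod_ite_mem, univ_inter, prod_const, card_singleton, pow_one,
    card_erase_of_mem hvef.1, card_erase_of_mem hvef.2, he, hf]
  rw [mul_assoc, ← mul_pow]
  have hxN : ((x : ℕ) : ℝ) ≤ N := by exact_mod_cast x.isLt.le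
  have ha : 0 ≤ a := by positivity
  have hb : 0 ≤ b := div_nonneg (by linarith) hN0.le
  have hab : a + b = 1 + 1 / (N : ℝ) := by
    simp only [a, b]; field_simp; ring
  gcongr
  rw [← hab]
  nlinarith [sq_nonneg (a - b)]

/-- Random weights in `Fin N` avoid ordered 2-chains with positive probability. -/
theorem exists_weight_no_ordered_chain {V ι : Type*} [Fintype V] [DecidableEq V] [Fintype ι]
    (H : ι → Finset V) {k N l : ℕ} (hN : 0 < N) (hl : 2 * l ≤ N) (hH : ∀ i, #(H i) = k)
    (hlt : 2 * Fintype.card ι * ((l : ℝ) / N) ^ k + (Fintype.card ι : ℝ) ^ 2 *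
      ((N - 2 * l) / N) * ((1 + 1 / (N : ℝ)) ^ 2 / 4) ^ (k - 1) < 1) :
    ∃ w : V → ℕ, ∀ i j v, H i ∩ H j = {v} →
      (∀ u ∈ H i, w u ≤ w v) → ¬ ∀ u ∈ H j, w v ≤ w u := by
  classical
  let lo : Finset (Fin N) := univ.filter fun x => (x : ℕ) < l
  let hi : Finset (Fin N) := univ.filter fun x => N - l ≤ (x : ℕ)
  let mid : Finset (Fin N) := univ.filter fun x => l ≤ (x : ℕ) ∧ (x : ℕ) < N - l
  have clo : #lo = l := by
    rw [← card_map Fin.valEmbedding, ← card_range l]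
    congr 1
    ext y
    simp only [lo, mem_map, mem_filter, mem_univ, true_and, Fin.valEmbedding_apply, mem_range]
    exact ⟨fun ⟨x, hx, hxy⟩ => hxy ▸ hx, fun hy => ⟨⟨y, by omega⟩, hy, rfl⟩⟩
  have chi : #hi = l := by
    have : #hi = #(Ico (N - l) N) := by
      rw [← card_map Fin.valEmbedding]
      congr 1
      ext y
      simp only [hi, mem_map, mem_filter, mem_univ, true_and, Fin.valEmbedding_apply, mem_Ico]
      exact ⟨fun ⟨x, hx, hxy⟩ => hxy ▸ ⟨hx, x.isLt⟩, fun hy => ⟨⟨y, hy.2⟩, hy.1, rfl⟩⟩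
    rw [this, Nat.card_Ico]; omega
  have cmid : #mid = N - 2 * l := by
    have : #mid = #(Ico l (N - l)) := by
      rw [← card_map Fin.valEmbedding]
      congr 1
      ext y
      simp only [mid, mem_map, mem_filter, mem_univ, true_and, Fin.valEmbedding_apply, mem_Ico]
      exact ⟨fun ⟨x, hx, hxy⟩ => hxy ▸ hx, fun hy => ⟨⟨y, by omega⟩, hy, rfl⟩⟩
    rw [this, Nat.card_Ico]; omega
  let inBox (i : ι) (T : Finset (Fin N)) : Finset (V → Fin N) :=
    Fintype.piFinset fun u => if u ∈ H i then T else univ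
  let chain (q : (ι × ι) × Fin N) : Finset (V → Fin N) :=
    if hv : ∃ v, H q.1.1 ∩ H q.1.2 = {v} then
      Fintype.piFinset fun u => if u = hv.choose then {q.2} else
        if u ∈ H q.1.1 then Iic q.2 else if u ∈ H q.1.2 then Ici q.2 else univ
    else ∅
  let bad : Finset (V → Fin N) := (univ.biUnion fun i => inBox i lo) ∪
    (univ.biUnion fun i => inBox i hi) ∪ ((univ : Finset (ι × ι)) ×ˢ mid).biUnion chain
  have hNpos : (0 : ℝ) < (N : ℝ) ^ Fintype.card V := by positivity
  have hchain : ∀ q, (#(chain q) : ℝ) / (N : ℝ) ^ Fintype.card V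
      ≤ 1 / N * ((1 + 1 / (N : ℝ)) ^ 2 / 4) ^ (k - 1) := by
    intro q
    simp only [chain]
    split_ifs with hv
    · exact card_piFinset_chain_div_le hN (hH _) (hH _) hv.choose_spec q.2
    · simp only [card_empty, Nat.cast_zero, zero_div]; positivity
  have hbad : (#bad : ℝ) / (N : ℝ) ^ Fintype.card V < 1 := by
    have h1 : #bad ≤ (∑ i, #(inBox i lo)) + (∑ i, #(inBox i hi)) +
        ∑ q ∈ (univ : Finset (ι × ι)) ×ˢ mid, #(chain q) :=
      (card_union_le _ _).trans (add_le_add ((card_union_le _ _).trans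
        (add_le_add card_biUnion_le card_biUnion_le)) card_biUnion_le)
    have h2 : (#bad : ℝ) ≤ (∑ i, (#(inBox i lo) : ℝ)) + (∑ i, (#(inBox i hi) : ℝ)) +
        ∑ q ∈ (univ : Finset (ι × ι)) ×ˢ mid, (#(chain q) : ℝ) := by exact_mod_cast h1
    refine lt_of_le_of_lt (div_le_div_of_nonneg_right h2 hNpos.le) (lt_of_le_of_lt ?_ hlt)
    rw [add_div, add_div, sum_div, sum_div, sum_div]
    have h3 := sum_le_card_nsmul ((univ : Finset (ι × ι)) ×ˢ mid) _ _ fun q _ => hchain q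
    simp only [inBox, card_piFinset_ite_div hN, clo, chi, hH, sum_const, card_univ, nsmul_eq_mul]
    rw [nsmul_eq_mul, card_product, card_univ, Fintype.card_prod, cmid] at h3
    push_cast [Nat.cast_sub hl] at h3
    refine (add_le_add le_rfl h3).trans (le_of_eq ?_)
    ring
  obtain ⟨w, hw⟩ : ∃ w, w ∉ bad := by
    by_contra! hall
    have : bad = univ := eq_univ_of_forall hall
    rw [this, card_univ, Fintype.card_fun, Fintype.card_fin, Nat.cast_pow, div_self hNpos.ne']
      at hbad
    exact lt_irrefl _ hbad
  simp only [bad, inBox, mem_union, mem_biUnion, mem_univ, true_and, mem_product, not_or,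
    not_exists, Fintype.mem_piFinset] at hw
  obtain ⟨⟨hw1, hw2⟩, hw3⟩ := hw
  refine ⟨fun u => w u, fun i j v hv hle hge => ?_⟩
  by_cases hvl : (w v : ℕ) < l
  · refine hw1 i fun u => ?_
    split_ifs with hu
    · simpa [lo] using (hle u hu).trans_lt hvl
    · exact mem_univ _
  by_cases hvh : N - l ≤ (w v : ℕ)
  · refine hw2 j fun u => ?_
    split_ifs with hu
    · simpa [hi] using hvh.trans (hge u hu)
    · exact mem_univ _
  refine hw3 ((i, j), w v) ⟨by simp only [mid, mem_filter, mem_univ, true_and]; omega, ?_⟩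
  have hex : ∃ v, H i ∩ H j = {v} := ⟨v, hv⟩
  have hch : hex.choose = v := singleton_injective (hex.choose_spec.symm.trans hv)
  simp only [chain, dif_pos hex, hch, Fintype.mem_piFinset]
  intro u
  split_ifs with h1 h2 h3
  · simp [h1]
  · exact mem_Iic.2 (hle u h2)
  · exact mem_Ici.2 (hge u h3)
  · exact mem_univ _

/-- The Radhakrishnan–Srinivasan bound for property B (Cherkashin–Kozik argument). -/
theorem exists_bicoloring_of_card_le {V ι : Type*} [Fintype V] [DecidableEq V] [Fintype ι]
    (H : ι → Finset V) {k : ℕ} (hk : 2 ≤ k) (hH : ∀ i, #(H i) = k) {c : ℝ} (hc : 0 ≤ c)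
    (hck : 2 * c / √(Real.log k) + 2 * c ^ 2 < 1)
    (hcard : (Fintype.card ι : ℝ) ≤ c * √((k : ℝ) / Real.log k) * 2 ^ k) :
    ∃ s : Set V, ∀ i, (∃ u ∈ H i, u ∈ s) ∧ ∃ u ∈ H i, u ∉ s := by
  have hk0 : (0 : ℝ) < k := by positivity
  have hk1 : (1 : ℝ) < k := by exact_mod_cast hk
  have hlog : 0 < Real.log k := Real.log_pos hk1
  set L := Real.log k with hL
  set m : ℝ := (Fintype.card ι : ℝ)
  have hm : 0 ≤ m := Nat.cast_nonneg _
  set p : ℝ := L / (2 * k) with hp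
  have hp0 : 0 < p := by positivity
  have hp1 : p < 1 := by
    rw [hp, div_lt_one (by positivity)]
    linarith [Real.log_le_sub_one_of_pos hk0]
  have hpow : (1 - p) ^ k ≤ 1 / √k := by
    have h1 : (1 - p) ^ k ≤ Real.exp (-p) ^ k :=
      pow_le_pow_left₀ (by linarith) (by linarith [Real.add_one_le_exp (-p)]) k
    refine h1.trans (le_of_eq ?_)
    rw [← Real.exp_nat_mul, one_div, Real.sqrt_eq_rpow, Real.rpow_def_of_pos hk0, ← Real.exp_neg]
    congr 1
    rw [hp, ← hL]
    field_simp
  let g : ℝ → ℝ := fun t => 2 * m * ((1 - p) / 2) ^ k +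
    m ^ 2 * (p + 2 * t) * ((1 + t) ^ 2 / 4) ^ (k - 1)
  have hg0 : g 0 < 1 := by
    refine lt_of_le_of_lt (add_le_add ?_ ?_) hck
    · calc 2 * m * ((1 - p) / 2) ^ k
          ≤ 2 * (c * √(k / L) * 2 ^ k) * ((1 - p) / 2) ^ k := by
            have : 0 ≤ (1 - p) / 2 := by linarith
            gcongr
        _ = 2 * c * √(k / L) * (1 - p) ^ k := by
            rw [div_pow]; field_simp
        _ ≤ 2 * c * √(k / L) * (1 / √k) := by gcongr
        _ = 2 * c / √L := by
            rw [Real.sqrt_div hk0.le]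
            have : 0 < √(k : ℝ) := Real.sqrt_pos.2 hk0
            field_simp
    · calc m ^ 2 * (p + 2 * 0) * ((1 + 0) ^ 2 / 4) ^ (k - 1)
          ≤ (c * √(k / L) * 2 ^ k) ^ 2 * (p + 2 * 0) * ((1 + 0) ^ 2 / 4) ^ (k - 1) := by
            have : 0 ≤ p + 2 * 0 := by linarith
            gcongr
        _ = 2 * c ^ 2 := by
            obtain ⟨n, rfl⟩ : ∃ n, k = n + 1 := ⟨k - 1, by omega⟩
            have h4 : ((2 : ℝ) ^ (n + 1)) ^ 2 = 4 * 4 ^ n := by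
              rw [← pow_mul, mul_comm, pow_mul]; norm_num [pow_succ]; ring
            rw [mul_pow, mul_pow, Real.sq_sqrt (by positivity), h4, Nat.add_sub_cancel, hp]
            simp only [mul_zero, add_zero, one_pow, one_div, inv_pow]
            field_simp
            ring
  have hlim : Filter.Tendsto (fun n : ℕ => g (1 / ((n : ℝ) + 1))) Filter.atTop (nhds (g 0)) :=
    ((by fun_prop : Continuous g).tendsto 0).comp tendsto_one_div_add_atTop_nhds_zero_nat
  obtain ⟨n, hn⟩ := (hlim.eventually_lt_const hg0).exists
  let N := n + 1
  let l := ⌊(1 - p) / 2 * (N : ℝ)⌋₊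
  have hN : (0 : ℝ) < N := by positivity
  have hl1 : (l : ℝ) ≤ (1 - p) / 2 * N := Nat.floor_le (by
    have : 0 ≤ (1 - p) / 2 := by linarith
    positivity)
  have hl2 : (1 - p) / 2 * (N : ℝ) < l + 1 := Nat.lt_floor_add_one _
  have hl : 2 * l ≤ N := by
    have : (2 * l : ℝ) ≤ N := by nlinarith
    exact_mod_cast this
  obtain ⟨w, hw⟩ := exists_weight_no_ordered_chain H (N := N) (l := l) (Nat.succ_pos n) hl hH <| by
    refine lt_of_le_of_lt ?_ hn
    have hNn : (n : ℝ) + 1 = N := by simp [N]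
    simp only [g, hNn]
    have h1 : (l : ℝ) / N ≤ (1 - p) / 2 := by rwa [div_le_iff₀ hN]
    have h2 : ((N : ℝ) - 2 * l) / N ≤ p + 2 * (1 / N) := by
      rw [div_le_iff₀ hN, add_mul, mul_assoc, one_div_mul_cancel hN.ne']
      linarith
    gcongr
  exact exists_bicoloring_of_no_ordered_chain H
    (fun i => card_pos.1 (by rw [hH i]; omega)) w hw

/-- A bicoloring of `A` in which no neighborhood of a vertex of `B` is monochromatic gives a
neighbor-distinguishing labeling. -/
theorem exists_labeling_of_bicoloring {V : Type*} [Fintype V] [DecidableEq V] (G : SimpleGraph V)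
    [DecidableRel G.Adj] (A B : Set V) (hAB : ∀ v : V, v ∈ A ↔ v ∉ B)
    (hG : ∀ u v : V, G.Adj u v → (u ∈ A ∧ v ∈ B) ∨ (u ∈ B ∧ v ∈ A)) (s : Set V)
    (hs : ∀ b ∈ B, (∃ u ∈ G.neighborFinset b, u ∈ s) ∧ ∃ u ∈ G.neighborFinset b, u ∉ s) :
    ∃ c : Sym2 V → Fin 2, ∀ u v : V, G.Adj u v →
      (G.incidenceFinset u).image c ≠ (G.incidenceFinset v).image c := by
  classical
  let c : Sym2 V → Fin 2 := fun e => if ∃ a ∈ e, a ∈ A ∧ a ∈ s then 1 else 0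
  have hc : ∀ a ∈ A, ∀ b ∈ B, c s(a, b) = if a ∈ s then 1 else 0 := by
    intro a ha b hb
    have hbA : b ∉ A := fun h => (hAB b).1 h hb
    simp [c, ha, hbA]
  have key : ∀ a ∈ A, ∀ b ∈ B,
      (G.incidenceFinset a).image c ≠ (G.incidenceFinset b).image c := by
    intro a ha b hb heq
    have hmono : ∀ y ∈ (G.incidenceFinset a).image c, y = if a ∈ s then 1 else 0 := by
      intro y hy
      obtain ⟨e, he, rfl⟩ := mem_image.1 hy
      rw [SimpleGraph.mem_incidenceFinset] at he
      obtain ⟨b', rfl⟩ := Sym2.mem_iff_exists.1 he.2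
      have hadj : G.Adj a b' := he.1
      rcases hG a b' hadj with h | h
      · exact hc a ha b' h.2
      · exact absurd h.1 ((hAB a).1 ha)
    have hmem : ∀ u ∈ G.neighborFinset b,
        (if u ∈ s then (1 : Fin 2) else 0) = if a ∈ s then 1 else 0 := by
      intro u hu
      rw [SimpleGraph.mem_neighborFinset] at hu
      have huA : u ∈ A := by
        rcases hG b u hu with h | h
        · exact absurd hb ((hAB b).1 h.1)
        · exact h.2
      rw [← hc u huA b hb]
      refine hmono _ (heq ▸ mem_image_of_mem c ?_)
      rw [SimpleGraph.mem_incidenceFinset]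
      exact ⟨hu.symm, Sym2.mem_mk_right u b⟩
    obtain ⟨⟨u, hu, hus⟩, u', hu', hus'⟩ := hs b hb
    have h1 := hmem u hu
    rw [← hmem u' hu', if_pos hus, if_neg hus'] at h1
    exact one_ne_zero h1
  refine ⟨c, fun u v huv => ?_⟩
  rcases hG u v huv with h | h
  · exact key u h.1 v h.2
  · exact (key v h.2 u h.1).symm

/-- Bipartite graphs with few vertices, all of degree `k`, on one side have `gndi` at most 2. -/
theorem exists_labeling_of_ncard_le {V : Type*} [Fintype V] [DecidableEq V] (G : SimpleGraph V)
    [DecidableRel G.Adj] (A B : Set V) {k : ℕ} (hk : 2 ≤ k) (hAB : ∀ v : V, v ∈ A ↔ v ∉ B)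
    (hG : ∀ u v : V, G.Adj u v → (u ∈ A ∧ v ∈ B) ∨ (u ∈ B ∧ v ∈ A))
    (hdeg : ∀ b ∈ B, G.degree b = k) {c : ℝ} (hc : 0 ≤ c)
    (hck : 2 * c / √(Real.log k) + 2 * c ^ 2 < 1)
    (hcard : (B.ncard : ℝ) ≤ c * √((k : ℝ) / Real.log k) * 2 ^ k) :
    ∃ c : Sym2 V → Fin 2, ∀ u v : V, G.Adj u v →
      (G.incidenceFinset u).image c ≠ (G.incidenceFinset v).image c := by
  classical
  obtain ⟨s, hs⟩ := exists_bicoloring_of_card_le (ι := B) (fun b => G.neighborFinset b) hk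
    (fun b => hdeg b b.2) hc hck (by rwa [← Nat.card_eq_fintype_card, Nat.card_coe_set_eq])
  exact exists_labeling_of_bicoloring G A B hAB hG s fun b hb => hs ⟨b, hb⟩

end


/-- Let `G` be a bipartite graph with classes `A`, `B` where every vertex of `B` has degree
exactly `k`.  If `|B| ≤ 0.1 √(k/ln k) 2^k`, then `G` has an edge labeling with two labels
distinguishing neighbors by sets (i.e. `gndi(G) = 2` when `G` has an edge).  Moreover, for
`k` sufficiently large the hypothesis can be weakened to `|B| ≤ 0.7 √(k/ln k) 2^k`. -/
theorem bipartite_gndi_two_of_card_le :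
    (∀ (V : Type) [Fintype V] [DecidableEq V] (G : SimpleGraph V) [DecidableRel G.Adj]
        (A B : Set V) (k : ℕ),
      (∀ v : V, v ∈ A ↔ v ∉ B) →
      (∀ u v : V, G.Adj u v → (u ∈ A ∧ v ∈ B) ∨ (u ∈ B ∧ v ∈ A)) →
      (∀ b ∈ B, G.degree b = k) →
      (B.ncard : ℝ) ≤ 0.1 * Real.sqrt ((k : ℝ) / Real.log (k : ℝ)) * 2 ^ k →
      ∃ c : Sym2 V → Fin 2, ∀ u v : V, G.Adj u v →
        (G.incidenceFinset u).image c ≠ (G.incidenceFinset v).image c) ∧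
    (∃ k₀ : ℕ, ∀ (V : Type) [Fintype V] [DecidableEq V] (G : SimpleGraph V)
        [DecidableRel G.Adj] (A B : Set V) (k : ℕ), k₀ ≤ k →
      (∀ v : V, v ∈ A ↔ v ∉ B) →
      (∀ u v : V, G.Adj u v → (u ∈ A ∧ v ∈ B) ∨ (u ∈ B ∧ v ∈ A)) →
      (∀ b ∈ B, G.degree b = k) →
      (B.ncard : ℝ) ≤ 0.7 * Real.sqrt ((k : ℝ) / Real.log (k : ℝ)) * 2 ^ k →
      ∃ c : Sym2 V → Fin 2, ∀ u v : V, G.Adj u v →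
        (G.incidenceFinset u).image c ≠ (G.incidenceFinset v).image c) := by
  refine ⟨fun V _ _ G _ A B k hAB hG hdeg hcard => ?_,
    ⌈Real.exp 10000⌉₊, fun V _ _ G _ A B k hk hAB hG hdeg hcard => ?_⟩
  · rcases lt_or_ge k 2 with hk | hk
    · have hB : B = ∅ := by
        have h0 : (B.ncard : ℝ) ≤ 0 := by interval_cases k <;> simpa using hcard
        exact (Set.ncard_eq_zero B.toFinite).1 (by exact_mod_cast h0.antisymm (Nat.cast_nonneg _))
      refine ⟨fun _ => 0, fun u v huv => ?_⟩
      rcases hG u v huv with h | h <;> simp [hB] at h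
    · refine exists_labeling_of_ncard_le G A B hk hAB hG hdeg (by norm_num) ?_ hcard
      have hlog : (0.25 : ℝ) ≤ Real.log k :=
        (by linarith [Real.log_two_gt_d9] : (0.25 : ℝ) ≤ Real.log 2).trans
          (Real.log_le_log (by norm_num) (by exact_mod_cast hk))
      have hsqrt : (0.5 : ℝ) ≤ √(Real.log k) := Real.le_sqrt_of_sq_le (by linarith)
      have : 2 * 0.1 / √(Real.log k) ≤ 0.4 := by
        rw [div_le_iff₀ (by linarith)]
        linarith
      linarith
  · have hkexp : Real.exp 10000 ≤ k := Nat.ceil_le.1 hk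
    have hk2 : 2 ≤ k := by
      have : (2 : ℝ) ≤ k := by linarith [Real.add_one_le_exp 10000]
      exact_mod_cast this
    refine exists_labeling_of_ncard_le G A B hk2 hAB hG hdeg (by norm_num) ?_ hcard
    have hlog : (10000 : ℝ) ≤ Real.log k := by
      rwa [Real.le_log_iff_exp_le (by positivity)]
    have hsqrt : (100 : ℝ) ≤ √(Real.log k) := Real.le_sqrt_of_sq_le (by linarith)
    have : 2 * 0.7 / √(Real.log k) ≤ 0.014 := by
      rw [div_le_iff₀ (by linarith)]
      linarith
    linarith
end
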